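/- arXiv:1811.09183 — 2 statements merged into one kernel-verified Lean document; each statement's English description precedes it below -/
import Mathlib

section
/- Let E and F be infinite dimensional Banach spaces, 1 ≤ r ≤ r_1 < (cot E)*, r ≤ a ≤ a_1 < ∞ and 1 ≤ s < ∞ with 1 − 1/s = 1/r − 1/a = 1/r_1 − 1/a_1. Then for a continuous linear operator u : E → F the following are equivalent: u is absolutely (a,r)-summing; u is absolutely (s,1)-summing; u is absolutely (a_1,r_1)-summing. -/
open scoped ENNReal NNReal BigOperators ZeroAtInfty

noncomputable section

/-- The `k`-th Rademacher function on `[0,1]`. -/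
def Rademacher (k : ℕ) (t : ℝ) : ℝ := (-1 : ℝ) ^ ⌊(2 : ℝ) ^ (k + 1) * t⌋

/-- A Banach space `E` has cotype `q` (for `2 ≤ q < ∞`). -/
def HasCotype (q : ℝ) (E : Type*) [NormedAddCommGroup E] [NormedSpace ℝ E] : Prop :=
  2 ≤ q ∧ ∃ C > 0, ∀ (n : ℕ) (x : Fin n → E),
    (∑ k : Fin n, ‖x k‖ ^ q) ^ (1 / q) ≤
      C * (∫ t in (0:ℝ)..(1:ℝ), ‖∑ k : Fin n, Rademacher k.1 t • x k‖ ^ 2) ^ ((1:ℝ) / 2)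

/-- `cot E`, the infimum of the cotypes of `E` (`∞` if `E` has no finite cotype). -/
def cot (E : Type*) [NormedAddCommGroup E] [NormedSpace ℝ E] : ℝ≥0∞ :=
  sInf {c : ℝ≥0∞ | ∃ q : ℝ, HasCotype q E ∧ c = ENNReal.ofReal q}

/-- Conjugate exponent in `ℝ≥0∞` : `p* = p/(p-1)`, with `1* = ∞` and `∞* = 1`. -/
def conjE (p : ℝ≥0∞) : ℝ≥0∞ := 1 + 1 / (p - 1)

/-- A sequence is weakly `p`-summable. -/
def WeaklySummable {E : Type*} [NormedAddCommGroup E] [NormedSpace ℝ E]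
    (p : ℝ) (x : ℕ → E) : Prop :=
  ∀ φ : E →L[ℝ] ℝ, Summable fun j => |φ (x j)| ^ p

/-- `u : E → F` is absolutely `(q,p)`-summing. -/
def AbsolutelySumming {E F : Type*} [NormedAddCommGroup E] [NormedSpace ℝ E]
    [NormedAddCommGroup F] [NormedSpace ℝ F] (q p : ℝ) (u : E →L[ℝ] F) : Prop :=
  ∀ x : ℕ → E, WeaklySummable p x → Summable fun j => ‖u (x j)‖ ^ q

/-- The weak `ℓ_p` norm of a sequence. -/
def weakNorm {E : Type*} [NormedAddCommGroup E] [NormedSpace ℝ E] (p : ℝ) (x : ℕ → E) : ℝ :=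
  ⨆ φ : {φ : E →L[ℝ] ℝ // ‖φ‖ ≤ 1}, (∑' j, |φ.1 (x j)| ^ p) ^ (1 / p)

/-- A continuous `m`-linear operator is multiple `(q,p)`-summing. -/
def MultipleSumming {m : ℕ} {E : Fin m → Type*} [∀ i, NormedAddCommGroup (E i)]
    [∀ i, NormedSpace ℝ (E i)] {F : Type*} [NormedAddCommGroup F] [NormedSpace ℝ F]
    (q p : ℝ) (T : ContinuousMultilinearMap ℝ E F) : Prop :=
  ∃ C > 0, ∀ x : (i : Fin m) → ℕ → E i, (∀ i, WeaklySummable p (x i)) →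
    (Summable fun j : Fin m → ℕ => ‖T (fun i => x i (j i))‖ ^ q) ∧
    (∑' j : Fin m → ℕ, ‖T (fun i => x i (j i))‖ ^ q) ^ (1 / q) ≤
      C * ∏ i, weakNorm p (x i)


section PisierDomination

variable {ι E : Type*} [NormedAddCommGroup E] [NormedSpace ℝ E]

/-- The tangent line inequality for `t ↦ t ^ q`. -/
lemma rpow_add_mul_sub_le_rpow {q b t : ℝ} (hq : 1 ≤ q) (hb : 0 ≤ b) (ht : 0 ≤ t) :
    b ^ q + q * b ^ (q - 1) * (t - b) ≤ t ^ q := by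
  rcases hb.eq_or_lt with rfl | hb
  · rcases hq.eq_or_lt with rfl | hq
    · simp
    · rw [Real.zero_rpow (by linarith), Real.zero_rpow (by linarith)]
      simpa using Real.rpow_nonneg ht q
  · have h := one_add_mul_self_le_rpow_one_add (s := t / b - 1) (by
      have := div_nonneg ht hb.le
      linarith) hq
    rw [add_sub_cancel, Real.div_rpow ht hb.le, le_div_iff₀ (by positivity)] at h
    rw [Real.rpow_sub_one hb.ne']
    calc _ = (1 + q * (t / b - 1)) * b ^ q := by field_simp
      _ ≤ _ := h

/-- Young's inequality for the exponents `q / (q - 1)` and `q`, multiplied by `q`. -/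
lemma rpow_sub_one_mul_le {q b t : ℝ} (hq : 1 ≤ q) (hb : 0 ≤ b) (ht : 0 ≤ t) :
    q * (b ^ (q - 1) * t) ≤ (q - 1) * b ^ q + t ^ q := by
  have h := rpow_add_mul_sub_le_rpow hq hb ht
  have : b ^ (q - 1) * b = b ^ q := by
    rcases hb.eq_or_lt with rfl | hb
    · simp [Real.zero_rpow (by linarith : q ≠ 0)]
    · rw [Real.rpow_sub_one hb.ne']; field_simp
  nlinarith

/-- Pisier's domination argument, up to an error `ε`. -/
lemma exists_weights_of_sum_rpow_le (S : Finset ι) (y : ι → E) {q K ε : ℝ} (hq : 1 ≤ q)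
    (hK : ∀ (m : ℕ) (f : Fin m → ι → ℝ), (∀ j, ∑ k, |f k j| ≤ 1) →
      ∑ k, ‖∑ j ∈ S, f k j • y j‖ ^ q ≤ K) (hε : 0 < ε) :
    ∃ w : ι → ℝ, (∀ j, 0 ≤ w j) ∧ ∑ j ∈ S, w j ≤ K ∧ ∀ g : ι → ℝ, (∀ j, |g j| ≤ 1) →
      ‖∑ j ∈ S, g j • y j‖ ^ q ≤ ε + q * ∑ j ∈ S, |g j| * w j := by
  set A : Set ℝ := {c | ∃ (m : ℕ) (f : Fin m → ι → ℝ), (∀ j, ∑ k, |f k j| ≤ 1) ∧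
    ∑ k, ‖∑ j ∈ S, f k j • y j‖ ^ q = c} with hA
  have hAb : BddAbove A := ⟨K, by rintro _ ⟨m, f, hf, rfl⟩; exact hK m f hf⟩
  have hAn : A.Nonempty := ⟨_, 0, fun _ _ => 0, by simp, rfl⟩
  have hle : ∀ (m : ℕ) (f : Fin m → ι → ℝ), (∀ j, ∑ k, |f k j| ≤ 1) →
      ∑ k, ‖∑ j ∈ S, f k j • y j‖ ^ q ≤ sSup A := fun m f hf => le_csSup hAb ⟨m, f, hf, rfl⟩
  have hsup : sSup A ≤ K := csSup_le hAn (by rintro _ ⟨m, f, hf, rfl⟩; exact hK m f hf)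
  obtain ⟨_, ⟨m, f, hf, rfl⟩, hlt⟩ := exists_lt_of_lt_csSup hAn (sub_lt_self _ hε)
  set x : Fin m → E := fun k => ∑ j ∈ S, f k j • y j with hx
  choose φ hφ1 hφ2 using fun k => exists_dual_vector'' ℝ (x k)
  have hφle : ∀ k z, φ k z ≤ ‖z‖ := fun k z =>
    (le_abs_self _).trans (by simpa using (φ k).le_of_opNorm_le (hφ1 k) z)
  set l : ι → ℝ := fun j => ∑ k, ‖x k‖ ^ (q - 1) * (f k j * φ k (y j)) with hl
  have hpair : ∀ h : ι → ℝ, ∑ j ∈ S, h j * l j =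
      ∑ k, ‖x k‖ ^ (q - 1) * φ k (∑ j ∈ S, (f k j * h j) • y j) := by
    intro h
    simp only [hl, map_sum, map_smul, smul_eq_mul, Finset.mul_sum]
    rw [Finset.sum_comm]
    exact Finset.sum_congr rfl fun _ _ => Finset.sum_congr rfl fun _ _ => by ring
  have hmul : ∀ h : ι → ℝ, (∀ j, |h j| ≤ 1) → ∀ j, ∑ k, |f k j * h j| ≤ 1 := by
    intro h hh j
    refine le_trans (Finset.sum_le_sum fun k _ => ?_) (hf j)
    rw [abs_mul]
    exact mul_le_of_le_one_right (abs_nonneg _) (hh j)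
  refine ⟨fun j => |l j|, fun j => abs_nonneg _, ?_, fun g hg => ?_⟩
  · have hσ : ∀ j, |(SignType.sign (l j) : ℝ)| ≤ 1 := by
      intro j
      rcases lt_trichotomy (l j) 0 with h | h | h <;> simp [h]
    have h1 : ∑ j ∈ S, |l j| = ∑ j ∈ S, (SignType.sign (l j) : ℝ) * l j :=
      Finset.sum_congr rfl fun j _ => (sign_mul_self (l j)).symm
    rw [h1, hpair]
    have h2 := hle m _ (hmul _ hσ)
    have h3 := hle m f hf
    have h4 : q * ∑ k, ‖x k‖ ^ (q - 1) *
        φ k (∑ j ∈ S, (f k j * (SignType.sign (l j) : ℝ)) • y j) ≤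
        (q - 1) * ∑ k, ‖x k‖ ^ q +
          ∑ k, ‖∑ j ∈ S, (f k j * (SignType.sign (l j) : ℝ)) • y j‖ ^ q := by
      rw [Finset.mul_sum, Finset.mul_sum, ← Finset.sum_add_distrib]
      refine Finset.sum_le_sum fun k _ => ?_
      refine le_trans ?_ (rpow_sub_one_mul_le hq (norm_nonneg _) (norm_nonneg _))
      gcongr
      exact hφle k _
    refine le_trans ?_ hsup
    have h5 : (q - 1) * ∑ k, ‖x k‖ ^ q ≤ (q - 1) * sSup A :=
      mul_le_mul_of_nonneg_left h3 (by linarith)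
    exact le_of_mul_le_mul_left (by linarith) (by linarith : 0 < q)
  · have hcons := hle (m + 1) (Fin.cons g fun k j => f k j * (1 - |g j|)) (by
      intro j
      simp only [Fin.sum_univ_succ, Fin.cons_zero, Fin.cons_succ, abs_mul]
      rw [← Finset.sum_mul, abs_of_nonneg (sub_nonneg.2 (hg j))]
      nlinarith [hf j, hg j, abs_nonneg (g j)])
    simp only [Fin.sum_univ_succ, Fin.cons_zero, Fin.cons_succ] at hcons
    have hlow : ∑ k, ‖x k‖ ^ q - q * ∑ j ∈ S, |g j| * l j ≤
        ∑ k, ‖∑ j ∈ S, (f k j * (1 - |g j|)) • y j‖ ^ q := by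
      rw [hpair, Finset.mul_sum, ← Finset.sum_sub_distrib]
      refine Finset.sum_le_sum fun k _ => ?_
      refine le_trans ?_ (rpow_add_mul_sub_le_rpow hq (norm_nonneg (x k)) (norm_nonneg _))
      have h6 := hφle k (∑ j ∈ S, (f k j * (1 - |g j|)) • y j)
      have h7 : ∑ j ∈ S, (f k j * (1 - |g j|)) • y j =
          x k - ∑ j ∈ S, (f k j * |g j|) • y j := by
        simp only [hx, ← Finset.sum_sub_distrib, ← sub_smul]
        exact Finset.sum_congr rfl fun _ _ => by congr 1; ring
      have h8 : φ k (x k) = ‖x k‖ := hφ2 k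
      rw [h7, map_sub, h8] at h6
      rw [h7]
      have h9 : 0 ≤ q * ‖x k‖ ^ (q - 1) := by positivity
      nlinarith
    have habs : ∑ j ∈ S, |g j| * l j ≤ ∑ j ∈ S, |g j| * |l j| :=
      Finset.sum_le_sum fun j _ => mul_le_mul_of_nonneg_left (le_abs_self _) (abs_nonneg _)
    have : q * ∑ j ∈ S, |g j| * l j ≤ q * ∑ j ∈ S, |g j| * |l j| :=
      mul_le_mul_of_nonneg_left habs (by linarith)
    linarith

open Filter Topology in
/-- Pisier's domination theorem for operators on `c₀`. -/
lemma exists_summable_weights (y : ℕ → E) {q K : ℝ} (hq : 1 ≤ q)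
    (hK : ∀ (S : Finset ℕ) (m : ℕ) (f : Fin m → ℕ → ℝ), (∀ j, ∑ k, |f k j| ≤ 1) →
      ∑ k, ‖∑ j ∈ S, f k j • y j‖ ^ q ≤ K) :
    ∃ w : ℕ → ℝ, (∀ j, 0 ≤ w j) ∧ Summable w ∧ ∀ (S : Finset ℕ) (g : ℕ → ℝ),
      (∀ j, |g j| ≤ 1) → ‖∑ j ∈ S, g j • y j‖ ^ q ≤ q * ∑ j ∈ S, |g j| * w j := by
  have hK0 : 0 ≤ K := by simpa using hK ∅ 0 (fun _ _ => 0) (by simp)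
  choose w hw0 hwK hw using fun n : ℕ => exists_weights_of_sum_rpow_le (Finset.range n) y hq
    (hK (Finset.range n)) (Nat.one_div_pos_of_nat (α := ℝ) (n := n))
  set w' : ℕ → ℕ → ℝ := fun n j => if j < n then w n j else 0 with hw'
  have hmem : ∀ n, w' n ∈ Set.univ.pi fun _ : ℕ => Set.Icc 0 K := by
    intro n j _
    simp only [hw']
    split_ifs with h
    · exact ⟨hw0 n j, (Finset.single_le_sum (fun i _ => hw0 n i)
        (Finset.mem_range.2 h)).trans (hwK n)⟩
    · exact ⟨le_rfl, hK0⟩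
  obtain ⟨v, hv, θ, hθ, hlim⟩ :=
    (isCompact_univ_pi fun _ : ℕ => isCompact_Icc (a := (0 : ℝ)) (b := K)).tendsto_subseq hmem
  have hlim' : ∀ j, Tendsto (fun n => w' (θ n) j) atTop (𝓝 (v j)) := fun j =>
    (tendsto_pi_nhds.1 hlim) j
  have hev : ∀ S : Finset ℕ, ∀ᶠ n in atTop, S ⊆ Finset.range (θ n) := by
    intro S
    obtain ⟨N, hN⟩ := S.exists_nat_subset_range
    filter_upwards [hθ.tendsto_atTop.eventually_ge_atTop N] with n hn
    exact hN.trans (Finset.range_mono hn)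
  have hagree : ∀ (S : Finset ℕ) n, S ⊆ Finset.range n → ∀ j ∈ S, w' n j = w n j :=
    fun S n h j hj => if_pos (Finset.mem_range.1 (h hj))
  have hv0 : ∀ j, 0 ≤ v j := fun j => (hv j trivial).1
  refine ⟨v, hv0, summable_of_sum_le hv0 (c := K) fun S => ?_, fun S g hg => ?_⟩
  · refine le_of_tendsto (tendsto_finsetSum S fun j _ => hlim' j) ?_
    filter_upwards [hev S] with n hn
    rw [Finset.sum_congr rfl (hagree S _ hn)]
    exact (Finset.sum_le_sum_of_subset_of_nonneg hn fun j _ _ => hw0 _ j).trans (hwK _)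
  · have h1 : Tendsto (fun n => 1 / ((θ n : ℝ) + 1) + q * ∑ j ∈ S, |g j| * w' (θ n) j) atTop
        (𝓝 (0 + q * ∑ j ∈ S, |g j| * v j)) :=
      (tendsto_one_div_add_atTop_nhds_zero_nat.comp hθ.tendsto_atTop).add
        ((tendsto_finsetSum S fun j _ => (hlim' j).const_mul _).const_mul _)
    rw [zero_add] at h1
    refine ge_of_tendsto h1 ?_
    filter_upwards [hev S] with n hn
    have h2 := hw (θ n) (fun j => if j ∈ S then g j else 0) (by
      intro j; split_ifs
      · exact hg j
      · simp)
    simp only [ite_smul, zero_smul, apply_ite abs, abs_zero, ite_mul, zero_mul,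
      Finset.sum_ite_mem, Finset.inter_eq_right.2 hn] at h2
    have h3 : ∑ j ∈ S, |g j| * w' (θ n) j = ∑ j ∈ S, |g j| * w (θ n) j :=
      Finset.sum_congr rfl fun j hj => by rw [hagree S _ hn j hj]
    rwa [h3]

end PisierDomination

section ScalarSeries

open Filter Topology

/-- A weak-type estimate for `h` with respect to the finite measure `w` implies a strong one. -/
lemma summable_mul_rpow_of_rpow_sum_le {w h : ℕ → ℝ} {q r K : ℝ} (hw0 : ∀ j, 0 ≤ w j)
    (hw : Summable w) (hh : ∀ j, 0 ≤ h j) (hq : 1 < q) (hr : 0 ≤ r) (hrq : r < q / (q - 1))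
    (hK0 : 0 ≤ K) (hK : ∀ S : Finset ℕ, (∑ j ∈ S, h j * w j) ^ q ≤ K * ∑ j ∈ S, w j) :
    Summable fun j => w j * h j ^ r := by
  have hweak : ∀ (S : Finset ℕ) (t : ℝ), 0 < t → (∀ j ∈ S, t ≤ h j) →
      ∑ j ∈ S, w j ≤ K ^ (1 / (q - 1)) * t ^ (-(q / (q - 1))) := by
    intro S t ht hS
    have hq1 : 0 < q - 1 := by linarith
    rcases (Finset.sum_nonneg fun j _ => hw0 j : 0 ≤ ∑ j ∈ S, w j).eq_or_lt with h0 | h0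
    · rw [← h0]; positivity
    · have h1 : (t * ∑ j ∈ S, w j) ^ q ≤ K * ∑ j ∈ S, w j := by
        refine le_trans (Real.rpow_le_rpow (by positivity) ?_ (by linarith)) (hK S)
        rw [Finset.mul_sum]
        exact Finset.sum_le_sum fun j hj => mul_le_mul_of_nonneg_right (hS j hj) (hw0 j)
      set W := ∑ j ∈ S, w j
      have h2 : W ^ (q - 1) ≤ K * t ^ (-q) := by
        rw [Real.mul_rpow ht.le h0.le] at h1
        rw [Real.rpow_sub_one h0.ne', Real.rpow_neg ht.le, div_le_iff₀ h0, ← div_eq_mul_inv,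
          div_mul_eq_mul_div, le_div_iff₀ (by positivity)]
        linarith
      have h3 := Real.rpow_le_rpow (by positivity) h2 (by positivity : 0 ≤ 1 / (q - 1))
      rw [← Real.rpow_mul h0.le, Real.mul_rpow hK0 (by positivity), ← Real.rpow_mul ht.le,
        mul_one_div_cancel hq1.ne', Real.rpow_one] at h3
      convert h3 using 3
      ring
  set ρ : ℝ := 2 ^ (r - q / (q - 1)) with hρ
  have hρ0 : 0 < ρ := by positivity
  have hρ1 : ρ < 1 := Real.rpow_lt_one_of_one_lt_of_neg (by norm_num) (by linarith)
  have hpt : ∀ j, ∃ n : ℕ, h j ^ r ≤ 1 ∨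
      ((2 : ℝ) ^ n ≤ h j ∧ h j ^ r ≤ 2 ^ r * ((2 : ℝ) ^ n) ^ r) := by
    intro j
    rcases le_total (h j) 1 with hj | hj
    · exact ⟨0, Or.inl (Real.rpow_le_one (hh j) hj hr)⟩
    · obtain ⟨n, hn1, hn2⟩ := exists_nat_pow_near hj (by norm_num : (1 : ℝ) < 2)
      refine ⟨n, Or.inr ⟨hn1, ?_⟩⟩
      rw [← Real.mul_rpow (by norm_num) (by positivity), ← pow_succ']
      exact Real.rpow_le_rpow (hh j) hn2.le hr
  choose n hn using hpt
  set D := 2 ^ r * K ^ (1 / (q - 1)) with hD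
  refine summable_of_sum_le (c := ∑' j, w j + D * ∑' k : ℕ, ρ ^ k)
    (fun j => mul_nonneg (hw0 j) (Real.rpow_nonneg (hh j) r)) fun S => ?_
  set N := S.sup n + 1
  have hnN : ∀ j ∈ S, n j ∈ Finset.range N := fun j hj =>
    Finset.mem_range.2 (Nat.lt_succ_of_le (Finset.le_sup hj))
  have hterm : ∀ j ∈ S, w j * h j ^ r ≤ w j + ∑ k ∈ Finset.range N,
      if (2 : ℝ) ^ k ≤ h j then 2 ^ r * ((2 : ℝ) ^ k) ^ r * w j else 0 := by
    intro j hj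
    have hpos : ∀ k ∈ Finset.range N,
        0 ≤ if (2 : ℝ) ^ k ≤ h j then 2 ^ r * ((2 : ℝ) ^ k) ^ r * w j else 0 := by
      intro k _
      have := hw0 j
      split_ifs <;> positivity
    rcases hn j with h1 | ⟨h1, h2⟩
    · have := mul_le_of_le_one_right (hw0 j) h1
      linarith [Finset.sum_nonneg hpos]
    · have h3 := Finset.single_le_sum hpos (hnN j hj)
      rw [if_pos h1] at h3
      have := mul_le_mul_of_nonneg_left h2 (hw0 j)
      linarith [hw0 j]
  have hlevel : ∀ k : ℕ, (∑ j ∈ S, if (2 : ℝ) ^ k ≤ h j then 2 ^ r * ((2 : ℝ) ^ k) ^ r * w j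
      else 0) ≤ D * ρ ^ k := by
    intro k
    rw [← Finset.sum_filter, ← Finset.mul_sum]
    have h1 := hweak (S.filter fun j => (2 : ℝ) ^ k ≤ h j) (2 ^ k) (by positivity)
      fun j hj => (Finset.mem_filter.1 hj).2
    refine (mul_le_mul_of_nonneg_left h1 (by positivity)).trans (le_of_eq ?_)
    have h2 : ρ ^ k = ((2 : ℝ) ^ k) ^ r * ((2 : ℝ) ^ k) ^ (-(q / (q - 1))) := by
      rw [← Real.rpow_add (by positivity), ← sub_eq_add_neg, hρ, ← Real.rpow_natCast,
        ← Real.rpow_natCast, ← Real.rpow_mul (by norm_num), ← Real.rpow_mul (by norm_num),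
        mul_comm]
    rw [h2, hD]
    ring
  calc _ ≤ ∑ j ∈ S, (w j + ∑ k ∈ Finset.range N,
        if (2 : ℝ) ^ k ≤ h j then 2 ^ r * ((2 : ℝ) ^ k) ^ r * w j else 0) :=
        Finset.sum_le_sum hterm
    _ ≤ ∑ j ∈ S, w j + ∑ k ∈ Finset.range N, D * ρ ^ k := by
        rw [Finset.sum_add_distrib, Finset.sum_comm]
        gcongr with k
        exact hlevel k
    _ ≤ _ := by
        rw [← Finset.mul_sum]
        gcongr
        · exact hw.sum_le_tsum _ fun j _ => hw0 j
        · exact (summable_geometric_of_lt_one hρ0.le hρ1).sum_le_tsum _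
            fun j _ => by positivity

/-- **Abel–Dini theorem**, divergence part. -/
lemma summable_of_summable_div_sum {d : ℕ → ℝ} (hd : ∀ n, 0 ≤ d n)
    (h : Summable fun n => d n / ∑ j ∈ Finset.range (n + 1), d j) : Summable d := by
  set s : ℕ → ℝ := fun n => ∑ j ∈ Finset.range n, d j with hs
  have hs0 : ∀ n, 0 ≤ s n := fun n => Finset.sum_nonneg fun j _ => hd j
  have hmono : Monotone s := monotone_nat_of_le_succ fun n => by
    simp only [hs, Finset.sum_range_succ]; linarith [hd n]
  obtain ⟨N, hN⟩ := ((tendsto_sum_nat_add fun n => d n / s (n + 1)).eventually_lt_const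
    (by norm_num : (0 : ℝ) < 1 / 2)).exists
  have hbound : ∀ m, s (m + N) ≤ 2 * s N := by
    intro m
    rcases (hs0 (m + N)).eq_or_lt with h0 | h0
    · linarith [hs0 N]
    have h1 : ∑ k ∈ Finset.range m, d (k + N) / s (k + N + 1) ≤ 1 / 2 :=
      (((summable_nat_add_iff N).2 h).sum_le_tsum _
        fun k _ => div_nonneg (hd _) (hs0 _)).trans hN.le
    have h2 : ∑ k ∈ Finset.range m, d (k + N) / s (m + N) ≤ 1 / 2 := by
      refine le_trans (Finset.sum_le_sum fun k hk => ?_) h1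
      rcases (hd (k + N)).eq_or_lt with h3 | h3
      · simp [← h3]
      have h4 : 0 < s (k + N + 1) := by
        simp only [hs, Finset.sum_range_succ]; linarith [hs0 (k + N)]
      exact div_le_div_of_nonneg_left (hd _) h4
        (hmono (by have := Finset.mem_range.1 hk; omega))
    rw [← Finset.sum_div, div_le_iff₀ h0] at h2
    have h5 : s (m + N) = s N + ∑ k ∈ Finset.range m, d (k + N) := by
      simp only [hs, add_comm m N, Finset.sum_range_add]
      simp only [add_comm N]
    linarith
  exact summable_of_sum_range_le hd (c := 2 * s N) fun n =>
    (hmono (Nat.le_add_right n N)).trans (hbound n)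

/-- **Abel–Dini theorem**, convergence part. -/
lemma summable_div_sum_rpow {d : ℕ → ℝ} (hd : ∀ n, 0 ≤ d n) {κ : ℝ} (hκ : 1 < κ) :
    Summable fun n => d n / (∑ j ∈ Finset.range (n + 1), d j) ^ κ := by
  set s : ℕ → ℝ := fun n => ∑ j ∈ Finset.range n, d j with hs
  have hs0 : ∀ n, 0 ≤ s n := fun n => Finset.sum_nonneg fun j _ => hd j
  have hsucc : ∀ n, s (n + 1) = s n + d n := fun n => Finset.sum_range_succ _ _
  have hmono : Monotone s := monotone_nat_of_le_succ fun n => by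
    rw [hsucc]; linarith [hd n]
  by_cases hN : ∃ N, 0 < s N
  swap
  · have hz : ∀ n, d n = 0 := fun n => by
      have h1 := not_exists.1 hN (n + 1)
      rw [hsucc] at h1
      linarith [hs0 n, hd n]
    simp [hz, summable_zero]
  obtain ⟨N, hN⟩ := hN
  have hpos : ∀ k, 0 < s (k + N) := fun k => hN.trans_le (hmono (Nat.le_add_left N k))
  have hc : 0 < κ - 1 := by linarith
  have hstep : ∀ x y : ℝ, 0 < x → x ≤ y →
      (y - x) / y ^ κ ≤ (x ^ (-(κ - 1)) - y ^ (-(κ - 1))) / (κ - 1) := by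
    intro x y hx hxy
    have hy : 0 < y := hx.trans_le hxy
    have h1 := Real.log_le_sub_one_of_pos (div_pos hx hy)
    have h2 := Real.add_one_le_exp (Real.log (x / y) * (-(κ - 1)))
    rw [← Real.rpow_def_of_pos (div_pos hx hy), Real.div_rpow hx.le hy.le,
      le_div_iff₀ (by positivity)] at h2
    rw [le_div_iff₀ hc]
    have h3 : (y - x) / y ^ κ = (1 - x / y) * y ^ (-(κ - 1)) := by
      rw [Real.rpow_neg hy.le, Real.rpow_sub_one hy.ne']
      field_simp
    rw [h3]
    have h4 : 0 < y ^ (-(κ - 1)) := by positivity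
    have h5 : (1 - x / y) * (κ - 1) ≤ Real.log (x / y) * (-(κ - 1)) := by nlinarith
    nlinarith
  rw [← summable_nat_add_iff N]
  refine summable_of_sum_range_le (c := s N ^ (-(κ - 1)) / (κ - 1))
    (fun k => div_nonneg (hd _) (Real.rpow_nonneg (hs0 _) _)) fun m => ?_
  have h1 : ∀ k, d (k + N) / s (k + N + 1) ^ κ ≤
      s (k + N) ^ (-(κ - 1)) / (κ - 1) - s (k + 1 + N) ^ (-(κ - 1)) / (κ - 1) := by
    intro k
    have h2 := hstep (s (k + N)) (s (k + N + 1)) (hpos k) (hmono (Nat.le_succ _))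
    rw [add_right_comm k 1 N, ← sub_div]
    convert h2 using 2
    rw [hsucc]; ring
  refine (Finset.sum_le_sum fun k _ => h1 k).trans ?_
  rw [Finset.sum_range_sub' fun k => s (k + N) ^ (-(κ - 1)) / (κ - 1)]
  have := hpos m
  have : 0 ≤ s (m + N) ^ (-(κ - 1)) / (κ - 1) := by positivity
  simp only [zero_add]
  linarith

/-- **Landau's theorem** on multipliers from `ℓ_t` to `ℓ_s`. -/
lemma summable_rpow_of_forall_summable_mul {b : ℕ → ℝ} (hb : ∀ j, 0 ≤ b j) {a s t : ℝ}
    (ha : 0 < a) (hs : 0 < s) (ht : 0 < t) (hast : 1 / s = 1 / a + 1 / t)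
    (h : ∀ l : ℕ → ℝ, (∀ j, 0 ≤ l j) → (Summable fun j => l j ^ t) →
      Summable fun j => (l j * b j) ^ s) :
    Summable fun j => b j ^ a := by
  have hd : ∀ j, 0 ≤ b j ^ a := fun j => Real.rpow_nonneg (hb j) a
  set σ : ℕ → ℝ := fun n => ∑ j ∈ Finset.range (n + 1), b j ^ a with hσ
  have hσ0 : ∀ n, 0 ≤ σ n := fun n => Finset.sum_nonneg fun j _ => hd j
  have hκ : 1 < t / s := by
    have h1 : t / s = 1 + t / a := by
      rw [div_eq_mul_one_div, hast]; field_simp; ring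
    have : 0 < t / a := by positivity
    linarith
  have hl0 : ∀ j, 0 ≤ b j ^ a / σ j ^ (t / s) := fun j =>
    div_nonneg (hd j) (Real.rpow_nonneg (hσ0 j) _)
  refine summable_of_summable_div_sum hd ?_
  refine (h (fun j => (b j ^ a / σ j ^ (t / s)) ^ (1 / t))
    (fun j => Real.rpow_nonneg (hl0 j) _) ?_).congr fun j => ?_
  · refine (summable_div_sum_rpow hd hκ).congr fun j => ?_
    rw [← Real.rpow_mul (hl0 j), one_div_mul_cancel ht.ne', Real.rpow_one]
  · rw [Real.mul_rpow (Real.rpow_nonneg (hl0 j) _) (hb j), ← Real.rpow_mul (hl0 j),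
      Real.div_rpow (hd j) (Real.rpow_nonneg (hσ0 j) _), ← Real.rpow_mul (hb j),
      ← Real.rpow_mul (hσ0 j)]
    have h1 : t / s * (1 / t * s) = 1 := by field_simp
    have h2 : a * (1 / t * s) + s = a := by
      field_simp at hast ⊢
      linarith
    rw [h1, Real.rpow_one, div_mul_eq_mul_div, ← Real.rpow_add_of_nonneg (hb j) (by positivity)
      hs.le, h2]

end ScalarSeries

section SummingOperators

variable {E F : Type*} [NormedAddCommGroup E] [NormedSpace ℝ E]
  [NormedAddCommGroup F] [NormedSpace ℝ F]

lemma exists_hasCotype_lt {r : ℝ} (hr : 1 < r) (h : ENNReal.ofReal r < conjE (cot E)) :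
    ∃ q, HasCotype q E ∧ r < q / (q - 1) := by
  by_contra! hcon
  have hr1 : 0 < r - 1 := by linarith
  have hle : ENNReal.ofReal (1 + 1 / (r - 1)) ≤ cot E := by
    refine le_sInf ?_
    rintro _ ⟨q, hq, rfl⟩
    refine ENNReal.ofReal_le_ofReal ?_
    have h1 := hcon q hq
    have hq1 : 0 < q - 1 := by linarith [hq.1]
    rw [div_le_iff₀ hq1] at h1
    rw [← le_sub_iff_add_le', div_le_iff₀ hr1]
    nlinarith
  have h2 : ENNReal.ofReal (1 / (r - 1)) ≤ cot E - 1 := by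
    refine le_trans (le_of_eq ?_) (tsub_le_tsub_right hle 1)
    rw [← ENNReal.ofReal_one, ← ENNReal.ofReal_sub _ zero_le_one, add_sub_cancel_left]
  have h3 : conjE (cot E) ≤ ENNReal.ofReal r := by
    have h4 : 1 / (cot E - 1) ≤ ENNReal.ofReal (r - 1) := by
      rw [one_div]
      refine (ENNReal.inv_le_inv.2 h2).trans (le_of_eq ?_)
      rw [← ENNReal.ofReal_inv_of_pos (by positivity), one_div, inv_inv]
    calc conjE (cot E) ≤ 1 + ENNReal.ofReal (r - 1) := add_le_add_right h4 1
      _ = ENNReal.ofReal r := by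
        rw [← ENNReal.ofReal_one, ← ENNReal.ofReal_add zero_le_one hr1.le, add_sub_cancel]
  exact absurd h (not_lt.2 h3)

lemma abs_rademacher (k : ℕ) (t : ℝ) : |Rademacher k t| = 1 := by
  simp [Rademacher, abs_zpow]

lemma HasCotype.exists_sum_rpow_le {q : ℝ} (h : HasCotype q E) :
    ∃ C : ℝ, ∀ (B : ℝ) (n : ℕ) (x : Fin n → E),
      (∀ c : Fin n → ℝ, (∀ k, |c k| ≤ 1) → ‖∑ k, c k • x k‖ ≤ B) →
        ∑ k, ‖x k‖ ^ q ≤ (C * B) ^ q := by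
  obtain ⟨hq, C, hC, h⟩ := h
  refine ⟨C, fun B n x hx => ?_⟩
  have hB : 0 ≤ B := by simpa using hx 0 (by simp)
  have h1 : |∫ t in (0:ℝ)..1, ‖∑ k : Fin n, Rademacher k.1 t • x k‖ ^ 2| ≤ B ^ 2 := by
    have := intervalIntegral.norm_integral_le_of_norm_le_const (a := 0) (b := 1) (C := B ^ 2)
      (f := fun t : ℝ => ‖∑ k : Fin n, Rademacher k.1 t • x k‖ ^ 2) fun t _ => by
        rw [Real.norm_of_nonneg (by positivity)]
        exact pow_le_pow_left₀ (norm_nonneg _) (hx _ fun k => (abs_rademacher k t).le) 2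
    simpa using this
  have h2 : (∑ k, ‖x k‖ ^ q) ^ (1 / q) ≤ C * B := by
    refine (h n x).trans (mul_le_mul_of_nonneg_left ?_ hC.le)
    rw [← Real.sqrt_eq_rpow]
    exact (Real.sqrt_le_sqrt ((le_abs_self _).trans h1)).trans_eq (Real.sqrt_sq hB)
  have h0 : 0 ≤ ∑ k, ‖x k‖ ^ q := Finset.sum_nonneg fun k _ => by positivity
  have h3 := Real.rpow_le_rpow (by positivity) h2 (by linarith : 0 ≤ q)
  rwa [← Real.rpow_mul h0, one_div_mul_cancel (by linarith), Real.rpow_one] at h3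

lemma WeaklySummable.exists_norm_sum_le {y : ℕ → E} (hy : WeaklySummable 1 y) :
    ∃ M : ℝ, ∀ (S : Finset ℕ) (g : ℕ → ℝ), (∀ j, |g j| ≤ 1) → ‖∑ j ∈ S, g j • y j‖ ≤ M := by
  let T : Finset ℕ × {g : ℕ → ℝ // ∀ j, |g j| ≤ 1} → (E →L[ℝ] ℝ) →L[ℝ] ℝ := fun i =>
    NormedSpace.inclusionInDoubleDual ℝ E (∑ j ∈ i.1, i.2.1 j • y j)
  obtain ⟨M, hM⟩ := banach_steinhaus (g := T) fun φ => by
    refine ⟨∑' j, |φ (y j)|, fun i => ?_⟩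
    have hφ : Summable fun j => |φ (y j)| := by simpa using hy φ
    have : T i φ = ∑ j ∈ i.1, i.2.1 j * φ (y j) := by
      simp [T, NormedSpace.dual_def]
    rw [this]
    refine (norm_sum_le _ _).trans ((Finset.sum_le_sum fun j _ => ?_).trans
      (hφ.sum_le_tsum i.1 fun j _ => abs_nonneg _))
    rw [norm_mul]
    exact mul_le_of_le_one_left (abs_nonneg _) (i.2.2 j)
  refine ⟨M, fun S g hg => ?_⟩
  exact ((NormedSpace.inclusionInDoubleDualLi ℝ (E := E)).norm_map _).symm.trans_le
    (hM (S, ⟨g, hg⟩))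

/-- In a space of cotype `q`, a weakly summable sequence is the product of a sequence in `ℓ_p`
and a weakly `r`-summable one, where `1 / p + 1 / r = 1` and `q < p`. -/
lemma HasCotype.exists_factorization {q r : ℝ} (hE : HasCotype q E) (hr : 1 < r)
    (hrq : r < q / (q - 1)) {y : ℕ → E} (hy : WeaklySummable 1 y) :
    ∃ (w : ℕ → ℝ) (z : ℕ → E), (∀ j, 0 ≤ w j) ∧ Summable w ∧ WeaklySummable r z ∧
      ∀ j, y j = w j ^ (1 - 1 / r) • z j := by
  have hq : 2 ≤ q := hE.1
  have hr0 : 0 < r := by linarith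
  have hr1 : 1 - 1 / r ≠ 0 := by
    rw [sub_ne_zero, ne_comm, ne_eq, div_eq_one_iff_eq hr0.ne']; exact hr.ne
  obtain ⟨M, hM⟩ := hy.exists_norm_sum_le
  obtain ⟨C, hC⟩ := hE.exists_sum_rpow_le
  obtain ⟨w, hw0, hw, hdom⟩ := exists_summable_weights y (q := q) (K := (C * M) ^ q)
    (by linarith) fun S m f hf => by
      refine hC M m _ fun c hc => ?_
      have h1 : ∑ k, c k • ∑ j ∈ S, f k j • y j = ∑ j ∈ S, (∑ k, c k * f k j) • y j := by
        simp only [Finset.smul_sum, Finset.sum_smul, smul_smul]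
        exact Finset.sum_comm
      rw [h1]
      refine hM S _ fun j => (Finset.abs_sum_le_sum_abs _ _).trans
        ((Finset.sum_le_sum fun k _ => ?_).trans (hf j))
      rw [abs_mul]
      exact mul_le_of_le_one_left (abs_nonneg _) (hc k)
  have hzero : ∀ j, w j = 0 → y j = 0 := by
    intro j hj
    have h1 := hdom {j} (fun _ => 1) (by simp)
    simp only [Finset.sum_singleton, one_smul, hj, mul_zero] at h1
    rcases (norm_nonneg (y j)).eq_or_lt with h2 | h2
    · exact norm_eq_zero.1 h2.symm
    · exact absurd h1 (not_le.2 (Real.rpow_pos_of_pos h2 q))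
  refine ⟨w, fun j => (w j ^ (1 - 1 / r))⁻¹ • y j, hw0, hw, fun φ => ?_, fun j => ?_⟩
  · have hcancel : ∀ j, |φ (y j)| / w j * w j = |φ (y j)| := fun j =>
      div_mul_cancel_of_imp fun hj => by simp [hzero j hj]
    have h1 : Summable fun j => w j * (|φ (y j)| / w j) ^ r := by
      refine summable_mul_rpow_of_rpow_sum_le hw0 hw (fun j => div_nonneg (abs_nonneg _) (hw0 j))
        (by linarith) hr0.le hrq (by positivity : 0 ≤ ‖φ‖ ^ q * q) fun S => ?_
      simp only [hcancel]
      have hσ : ∀ j, |(SignType.sign (φ (y j)) : ℝ)| ≤ 1 := by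
        intro j
        rcases lt_trichotomy (φ (y j)) 0 with h | h | h <;> simp [h]
      have h2 : ∑ j ∈ S, |φ (y j)| ≤ ‖φ‖ * ‖∑ j ∈ S, (SignType.sign (φ (y j)) : ℝ) • y j‖ := by
        refine le_trans (le_of_eq ?_) ((le_abs_self _).trans (φ.le_opNorm _))
        simp [map_sum]
      refine (Real.rpow_le_rpow (Finset.sum_nonneg fun j _ => abs_nonneg _) h2
        (by linarith)).trans ?_
      rw [Real.mul_rpow (norm_nonneg _) (norm_nonneg _), mul_assoc]
      refine mul_le_mul_of_nonneg_left ((hdom S _ hσ).trans ?_) (by positivity)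
      gcongr with j
      exact mul_le_of_le_one_left (hw0 j) (hσ j)
    refine h1.congr fun j => ?_
    rcases (hw0 j).eq_or_lt with h0 | h0
    · simp [hzero j h0.symm, ← h0, Real.zero_rpow hr0.ne']
    · rw [map_smul, smul_eq_mul, abs_mul,
        abs_of_nonneg (by positivity : 0 ≤ (w j ^ (1 - 1 / r))⁻¹),
        Real.mul_rpow (by positivity) (abs_nonneg _), Real.div_rpow (abs_nonneg _) h0.le,
        ← Real.rpow_neg h0.le, ← Real.rpow_mul h0.le]
      have h3 : -(1 - 1 / r) * r = 1 - r := by field_simp; ring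
      rw [h3, Real.rpow_sub h0, Real.rpow_one]
      ring
  · rcases (hw0 j).eq_or_lt with h0 | h0
    · simp [hzero j h0.symm]
    · rw [smul_inv_smul₀ (by positivity)]

/-- The inclusion theorem for absolutely summing operators. -/
lemma AbsolutelySumming.of_one {a r s : ℝ} {u : E →L[ℝ] F} (hr : 1 < r) (ha : 0 < a)
    (hs : 0 < s) (h : 1 - 1 / s = 1 / r - 1 / a) (hu : AbsolutelySumming s 1 u) :
    AbsolutelySumming a r u := by
  intro x hx
  have hconj := Real.HolderConjugate.conjExponent hr
  have hsum := hconj.inv_add_inv_eq_one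
  refine summable_rpow_of_forall_summable_mul (fun j => norm_nonneg _) ha hs hconj.symm.pos
    (by simp only [one_div] at h ⊢; linarith) fun l hl0 hl => ?_
  refine (hu (fun j => l j • x j) fun φ => ?_).congr fun j => by
    rw [map_smul, norm_smul, Real.norm_of_nonneg (hl0 j)]
  refine Summable.of_nonneg_of_le (fun j => by positivity) (fun j => ?_)
    (((hx φ).div_const r).add (hl.div_const r.conjExponent))
  rw [Real.rpow_one, map_smul, smul_eq_mul, abs_mul, abs_of_nonneg (hl0 j), mul_comm]
  exact Real.young_inequality_of_nonneg (abs_nonneg _) (hl0 j) hconj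

lemma AbsolutelySumming.one_of_lt_conjE_cot {a r s : ℝ} {u : E →L[ℝ] F} (hr : 1 < r)
    (hrE : ENNReal.ofReal r < conjE (cot E)) (ha : 0 < a) (hs : 0 < s)
    (h : 1 - 1 / s = 1 / r - 1 / a) (hu : AbsolutelySumming a r u) :
    AbsolutelySumming s 1 u := by
  intro y hy
  obtain ⟨q, hq, hrq⟩ := exists_hasCotype_lt hr hrE
  obtain ⟨w, z, hw0, hw, hz, hyz⟩ := hq.exists_factorization hr hrq hy
  have hr1 : 0 ≤ 1 - 1 / r := by
    rw [sub_nonneg, div_le_one (by linarith)]; exact hr.le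
  refine Summable.of_nonneg_of_le (fun j => by positivity) (fun j => ?_)
    ((hw.mul_left ((1 - 1 / r) * s)).add ((hu z hz).mul_left (s / a)))
  rw [hyz, map_smul, norm_smul, Real.norm_of_nonneg (Real.rpow_nonneg (hw0 j) _),
    Real.mul_rpow (Real.rpow_nonneg (hw0 j) _) (norm_nonneg _), ← Real.rpow_mul (hw0 j)]
  have h1 : (1 - 1 / r) * s + s / a = 1 := by
    have : 1 / s * s = 1 := one_div_mul_cancel hs.ne'
    rw [show 1 - 1 / r = 1 / s - 1 / a by linarith, sub_mul, this]
    ring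
  have h2 := Real.geom_mean_le_arith_mean2_weighted (mul_nonneg hr1 hs.le)
    (by positivity : 0 ≤ s / a) (hw0 j) (by positivity : 0 ≤ ‖u (z j)‖ ^ a) h1
  rwa [← Real.rpow_mul (norm_nonneg _), mul_div_cancel₀ _ ha.ne'] at h2

lemma absolutelySumming_iff_one {a r s : ℝ} {u : E →L[ℝ] F} (hr : 1 ≤ r)
    (hrE : ENNReal.ofReal r < conjE (cot E)) (ha : 0 < a) (hs : 0 < s)
    (h : 1 - 1 / s = 1 / r - 1 / a) :
    AbsolutelySumming a r u ↔ AbsolutelySumming s 1 u := by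
  rcases hr.eq_or_lt with rfl | hr
  · have : a = s := by
      rw [← one_div_one_div a, ← one_div_one_div s]; congr 1; linarith
    rw [this]
  · exact ⟨.one_of_lt_conjE_cot hr hrE ha hs h, .of_one hr ha hs h⟩

end SummingOperators

/-- with `1 − 1/s = 1/r − 1/a = 1/r₁ − 1/a₁` the classes of `(a,r)`-,
`(s,1)`- and `(a₁,r₁)`-summing operators coincide. -/
theorem stmt9 (E F : Type*) [NormedAddCommGroup E] [NormedSpace ℝ E] [CompleteSpace E]
    [NormedAddCommGroup F] [NormedSpace ℝ F] [CompleteSpace F]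
    (hE : ¬ FiniteDimensional ℝ E) (hF : ¬ FiniteDimensional ℝ F)
    (r r₁ a a₁ s : ℝ) (hr : 1 ≤ r) (hrr : r ≤ r₁)
    (hr₁ : ENNReal.ofReal r₁ < conjE (cot E))
    (hra : r ≤ a) (haa : a ≤ a₁) (hs : 1 ≤ s)
    (heq1 : 1 - 1 / s = 1 / r - 1 / a) (heq2 : 1 / r - 1 / a = 1 / r₁ - 1 / a₁)
    (u : E →L[ℝ] F) :
    (AbsolutelySumming a r u ↔ AbsolutelySumming s 1 u) ∧
    (AbsolutelySumming s 1 u ↔ AbsolutelySumming a₁ r₁ u) := by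
  have ha : 0 < a := by linarith
  exact ⟨absolutelySumming_iff_one hr ((ENNReal.ofReal_le_ofReal hrr).trans_lt hr₁) ha
      (by linarith) heq1,
    (absolutelySumming_iff_one (hr.trans hrr) hr₁ (by linarith) (by linarith)
      (heq1.trans heq2)).symm⟩

end
end

section
/- (Kwapień) Let 1 ≤ p ≤ ∞ and define r(p) by 1/r(p) = 1 − |1/p − 1/2|. Then every continuous linear operator from ℓ_1 to ℓ_p is absolutely (r(p),1)-summing. Moreover, for every 1 ≤ r < r(p) there exists a continuous linear operator from ℓ_1 to ℓ_p that is not absolutely (r,1)-summing. -/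
open scoped ENNReal NNReal BigOperators ZeroAtInfty

noncomputable section

/-- The sign `±1` attached to a Boolean. -/
def boolSign (b : Bool) : ℝ := if b then -1 else 1

/-- The Rademacher sum with coefficients `y`, evaluated at a choice of signs. -/
def rademacherSum {n : ℕ} (y : Fin n → ℝ) (ε : Fin n → Bool) : ℝ := ∑ k, boolSign (ε k) * y k

theorem sum_fin_succ_bool {n : ℕ} (F : (Fin (n + 1) → Bool) → ℝ) :
    ∑ ε, F ε = ∑ ε : Fin n → Bool, (F (Fin.cons true ε) + F (Fin.cons false ε)) := by
  rw [← (Fin.consEquiv (fun _ : Fin (n + 1) => Bool)).sum_comp, Fintype.sum_prod_type]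
  simp [Fin.consEquiv, Finset.sum_add_distrib]

theorem rademacherSum_cons {n : ℕ} (y : Fin (n + 1) → ℝ) (b : Bool) (ε : Fin n → Bool) :
    rademacherSum y (Fin.cons b ε) = boolSign b * y 0 + rademacherSum (fun k => y k.succ) ε := by
  simp [rademacherSum, Fin.sum_univ_succ]

theorem sum_rademacherSum_mul {n : ℕ} (y w : Fin n → ℝ) :
    ∑ ε, rademacherSum y ε * rademacherSum w ε = 2 ^ n * ∑ k, y k * w k := by
  induction n with
  | zero => simp [rademacherSum]
  | succ n ih =>
    rw [sum_fin_succ_bool, Fin.sum_univ_succ, pow_succ]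
    have h : ∀ ε : Fin n → Bool,
        rademacherSum y (Fin.cons true ε) * rademacherSum w (Fin.cons true ε) +
          rademacherSum y (Fin.cons false ε) * rademacherSum w (Fin.cons false ε) =
        2 * (rademacherSum (fun k => y k.succ) ε * rademacherSum (fun k => w k.succ) ε) +
          2 * (y 0 * w 0) := by
      intro ε
      simp only [rademacherSum_cons, boolSign]
      simp only [if_true, Bool.false_eq_true, if_false]
      ring
    simp only [h, Finset.sum_add_distrib, ← Finset.mul_sum, ih]
    simp
    ring

theorem sum_rademacherSum_pow_four_le {n : ℕ} (y : Fin n → ℝ) :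
    ∑ ε, rademacherSum y ε ^ 4 ≤ 2 ^ n * (3 * (∑ k, y k ^ 2) ^ 2) := by
  induction n with
  | zero => simp [rademacherSum]
  | succ n ih =>
    rw [sum_fin_succ_bool, Fin.sum_univ_succ, pow_succ]
    have h : ∀ ε : Fin n → Bool,
        rademacherSum y (Fin.cons true ε) ^ 4 + rademacherSum y (Fin.cons false ε) ^ 4 =
        2 * rademacherSum (fun k => y k.succ) ε ^ 4 +
          12 * y 0 ^ 2 *
            (rademacherSum (fun k => y k.succ) ε * rademacherSum (fun k => y k.succ) ε) +
          2 * y 0 ^ 4 := by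
      intro ε
      simp only [rademacherSum_cons, boolSign]
      simp only [if_true, Bool.false_eq_true, if_false]
      ring
    simp only [h, Finset.sum_add_distrib, ← Finset.mul_sum, sum_rademacherSum_mul]
    have h2 := ih (fun k => y k.succ)
    simp only [Finset.sum_const, Finset.card_univ, Fintype.card_fun, Fintype.card_bool,
      Fintype.card_fin, nsmul_eq_mul, ← sq]
    push_cast
    have : 0 ≤ (2 : ℝ) ^ n * y 0 ^ 4 := by positivity
    nlinarith [this, h2]

/-- The bilinear form on `ℓ_∞ × ℓ_∞` with matrix `a` has norm at most `A`. -/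
def SignBound {ι τ : Type} [Fintype ι] [Fintype τ] (a : ι → τ → ℝ) (A : ℝ) : Prop :=
  ∀ (s : ι → ℝ) (t : τ → ℝ), (∀ i, |s i| ≤ 1) → (∀ j, |t j| ≤ 1) →
    ∑ i, ∑ j, a i j * (s i * t j) ≤ A

/-- The form with matrix `a`, with vector entries from Euclidean unit balls, is bounded by `K`. -/
def VectorBound {ι τ : Type} [Fintype ι] [Fintype τ] (a : ι → τ → ℝ) (K : ℝ) : Prop :=
  ∀ (n : ℕ) (y : ι → Fin n → ℝ) (w : τ → Fin n → ℝ), (∀ i, ∑ k, y i k ^ 2 ≤ 1) →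
    (∀ j, ∑ k, w j k ^ 2 ≤ 1) → ∑ i, ∑ j, a i j * ∑ k, y i k * w j k ≤ K

section

variable {ι τ : Type} [Fintype ι] [Fintype τ]

theorem VectorBound.fintype {a : ι → τ → ℝ} {K : ℝ} (h : VectorBound a K) {κ : Type} [Fintype κ]
    (y : ι → κ → ℝ) (w : τ → κ → ℝ) (hy : ∀ i, ∑ k, y i k ^ 2 ≤ 1)
    (hw : ∀ j, ∑ k, w j k ^ 2 ≤ 1) : ∑ i, ∑ j, a i j * ∑ k, y i k * w j k ≤ K := by
  let e := Fintype.equivFin κ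
  have := h (Fintype.card κ) (fun i k => y i (e.symm k)) (fun i k => w i (e.symm k))
    (fun i => by rw [e.symm.sum_comp (fun k => y i k ^ 2)]; exact hy i)
    (fun i => by rw [e.symm.sum_comp (fun k => w i k ^ 2)]; exact hw i)
  convert this using 5 with i _ j _
  exact (e.symm.sum_comp (fun k => y i k * w j k)).symm

theorem VectorBound.scaled {a : ι → τ → ℝ} {K : ℝ} (h : VectorBound a K) {κ : Type} [Fintype κ]
    (y : ι → κ → ℝ) (w : τ → κ → ℝ) {b c : ℝ} (hb : 0 < b) (hc : 0 < c)
    (hy : ∀ i, ∑ k, y i k ^ 2 ≤ b ^ 2) (hw : ∀ j, ∑ k, w j k ^ 2 ≤ c ^ 2) :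
    ∑ i, ∑ j, a i j * ∑ k, y i k * w j k ≤ b * c * K := by
  have := h.fintype (fun i k => y i k / b) (fun j k => w j k / c)
    (fun i => by
      simp only [div_pow, ← Finset.sum_div]; rw [div_le_one (by positivity)]; exact hy i)
    (fun i => by
      simp only [div_pow, ← Finset.sum_div]; rw [div_le_one (by positivity)]; exact hw i)
  have h2 : ∑ i, ∑ j, a i j * ∑ k, y i k * w j k =
      b * c * ∑ i, ∑ j, a i j * ∑ k, y i k / b * (w j k / c) := by
    simp only [Finset.mul_sum]
    refine Finset.sum_congr rfl fun i _ => Finset.sum_congr rfl fun j _ =>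
      Finset.sum_congr rfl fun k _ => ?_
    field_simp
  rw [h2]
  gcongr

/-- Truncation of a real number at level `2`. -/
def clampTwo (t : ℝ) : ℝ := max (-2) (min 2 t)

theorem abs_clampTwo_le_two (t : ℝ) : |clampTwo t| ≤ 2 := by
  rw [abs_le]; unfold clampTwo; constructor
  · exact le_max_left _ _
  · exact max_le (by norm_num) (min_le_left _ _)

theorem sq_clampTwo_le (t : ℝ) : clampTwo t ^ 2 ≤ t ^ 2 := by
  unfold clampTwo
  rcases le_total 2 t with h | h
  · rw [min_eq_left h, max_eq_right (by norm_num)]; nlinarith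
  · rw [min_eq_right h]
    rcases le_total (-2) t with h' | h'
    · rw [max_eq_right h']
    · rw [max_eq_left h']; nlinarith

theorem sq_sub_clampTwo_le (t : ℝ) : (t - clampTwo t) ^ 2 ≤ t ^ 4 / 64 := by
  unfold clampTwo
  rcases le_total 2 t with h | h
  · rw [min_eq_left h, max_eq_right (by norm_num)]
    have : t - 2 ≤ t ^ 2 / 8 := by nlinarith [sq_nonneg (t - 4)]
    calc (t - 2) ^ 2 ≤ (t ^ 2 / 8) ^ 2 := pow_le_pow_left₀ (by linarith) this 2
      _ = _ := by ring
  · rw [min_eq_right h]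
    rcases le_total (-2) t with h' | h'
    · rw [max_eq_right h', sub_self, zero_pow two_ne_zero]; positivity
    · rw [max_eq_left h']
      have : -t - 2 ≤ t ^ 2 / 8 := by nlinarith [sq_nonneg (t + 4)]
      calc (t - -2) ^ 2 = (-t - 2) ^ 2 := by ring
        _ ≤ (t ^ 2 / 8) ^ 2 := pow_le_pow_left₀ (by linarith) this 2
        _ = _ := by ring

theorem SignBound.scaled_two {a : ι → τ → ℝ} {A : ℝ} (ha : SignBound a A) (s : ι → ℝ) (t : τ → ℝ)
    (hs : ∀ i, |s i| ≤ 2) (ht : ∀ j, |t j| ≤ 2) : ∑ i, ∑ j, a i j * (s i * t j) ≤ 4 * A := by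
  have := ha (fun i => s i / 2) (fun j => t j / 2)
    (fun i => by rw [abs_div, abs_two]; linarith [hs i])
    (fun i => by rw [abs_div, abs_two]; linarith [ht i])
  have h2 : ∑ i, ∑ j, a i j * (s i * t j) = 4 * ∑ i, ∑ j, a i j * (s i / 2 * (t j / 2)) := by
    simp only [Finset.mul_sum]
    refine Finset.sum_congr rfl fun i _ => Finset.sum_congr rfl fun j _ => by ring
  linarith

theorem VectorBound.improve {a : ι → τ → ℝ} {A K : ℝ} (ha : SignBound a A)
    (h : VectorBound a K) : VectorBound a (4 * A + K / 2) := by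
  intro n y w hy hw
  set N : ℝ := 2 ^ n with hN
  have hN0 : 0 < N := by positivity
  have hX : ∀ {y : Fin n → ℝ}, ∑ k, y k ^ 2 ≤ 1 → ∑ ε, rademacherSum y ε ^ 2 ≤ N := by
    intro y hy
    simp only [sq, sum_rademacherSum_mul] at hy ⊢
    exact mul_le_of_le_one_right hN0.le hy
  have hT : ∀ {y : Fin n → ℝ}, ∑ k, y k ^ 2 ≤ 1 →
      ∑ ε, clampTwo (rademacherSum y ε) ^ 2 ≤ N := fun hy =>
    (Finset.sum_le_sum fun ε _ => sq_clampTwo_le _).trans (hX hy)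
  have hR : ∀ {y : Fin n → ℝ}, ∑ k, y k ^ 2 ≤ 1 →
      ∑ ε, (rademacherSum y ε - clampTwo (rademacherSum y ε)) ^ 2 ≤ N / 16 := by
    intro y hy
    refine (Finset.sum_le_sum fun ε _ => sq_sub_clampTwo_le _).trans ?_
    rw [← Finset.sum_div]
    have h1 := sum_rademacherSum_pow_four_le y
    have h0 : 0 ≤ ∑ k, y k ^ 2 := Finset.sum_nonneg fun k _ => sq_nonneg _
    have h2 : (∑ k, y k ^ 2) ^ 2 ≤ 1 := pow_le_one₀ h0 hy
    nlinarith
  obtain ⟨q, hs0, hs⟩ : ∃ q : ℝ, 0 < q ∧ q ^ 2 = N :=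
    ⟨√N, Real.sqrt_pos.2 hN0, Real.sq_sqrt hN0.le⟩
  have hq : N / 16 = (q / 4) ^ 2 := by rw [div_pow, hs]; norm_num
  have e1 := h.scaled (fun i ε => clampTwo (rademacherSum (y i) ε))
    (fun j ε => rademacherSum (w j) ε - clampTwo (rademacherSum (w j) ε)) hs0
    (by positivity : 0 < q / 4) (fun i => (hT (hy i)).trans_eq hs.symm) (fun j => (hR (hw j)).trans_eq hq)
  have e2 := h.scaled (fun i ε => rademacherSum (y i) ε - clampTwo (rademacherSum (y i) ε))
    (fun j ε => rademacherSum (w j) ε)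
    (by positivity : 0 < q / 4) hs0 (fun j => (hR (hy j)).trans_eq hq) (fun i => (hX (hw i)).trans_eq hs.symm)
  have e3 : ∑ i, ∑ j, a i j * ∑ ε, clampTwo (rademacherSum (y i) ε) *
      clampTwo (rademacherSum (w j) ε) ≤ N * (4 * A) := by
    calc _ = ∑ ε, ∑ i, ∑ j, a i j * (clampTwo (rademacherSum (y i) ε) *
      clampTwo (rademacherSum (w j) ε)) := by
          symm
          rw [Finset.sum_comm]
          refine Finset.sum_congr rfl fun i _ => ?_
          rw [Finset.sum_comm]
          simp only [Finset.mul_sum]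
      _ ≤ ∑ ε : Fin n → Bool, 4 * A := Finset.sum_le_sum fun ε _ =>
          ha.scaled_two _ _ (fun _ => abs_clampTwo_le_two _) (fun _ => abs_clampTwo_le_two _)
      _ = _ := by simp [hN]
  have key : N * ∑ i, ∑ j, a i j * ∑ k, y i k * w j k =
      (∑ i, ∑ j, a i j * ∑ ε, clampTwo (rademacherSum (y i) ε) *
        clampTwo (rademacherSum (w j) ε)) +
      (∑ i, ∑ j, a i j * ∑ ε, clampTwo (rademacherSum (y i) ε) *
        (rademacherSum (w j) ε - clampTwo (rademacherSum (w j) ε))) +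
      ∑ i, ∑ j, a i j * ∑ ε, (rademacherSum (y i) ε - clampTwo (rademacherSum (y i) ε)) *
        rademacherSum (w j) ε := by
    simp only [← Finset.sum_add_distrib, ← mul_add]
    rw [Finset.mul_sum]
    refine Finset.sum_congr rfl fun i _ => ?_
    rw [Finset.mul_sum]
    refine Finset.sum_congr rfl fun j _ => ?_
    rw [mul_left_comm, ← sum_rademacherSum_mul]
    congr 1
    exact Finset.sum_congr rfl fun ε _ => by ring
  have hfin : N * ∑ i, ∑ j, a i j * ∑ k, y i k * w j k ≤ N * (4 * A + K / 2) := by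
    rw [key]
    have : q * (q / 4) * K = N * (K / 4) := by rw [← hs]; ring
    have : q / 4 * q * K = N * (K / 4) := by rw [← hs]; ring
    nlinarith
  exact le_of_mul_le_mul_left hfin hN0

/-- **Grothendieck's inequality**, with constant `8`. -/
theorem SignBound.vectorBound {a : ι → τ → ℝ} {A : ℝ} (ha : SignBound a A) :
    VectorBound a (8 * A) := by
  set S : ℝ := ∑ i, ∑ j, |a i j| with hS
  have h0 : VectorBound a (8 * A + S) := by
    intro n y w hy hw
    have hA : 0 ≤ A := by simpa using ha 0 0 (by simp) (by simp)
    suffices ∑ i, ∑ j, a i j * ∑ k, y i k * w j k ≤ S by linarith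
    refine Finset.sum_le_sum fun i _ => Finset.sum_le_sum fun j _ => ?_
    refine (le_abs_self _).trans ?_
    rw [abs_mul]
    refine mul_le_of_le_one_right (abs_nonneg _) (abs_le_one_iff_mul_self_le_one.2 ?_)
    rw [← sq]
    refine (Finset.sum_mul_sq_le_sq_mul_sq _ _ _).trans ?_
    exact mul_le_one₀ (hy i) (Finset.sum_nonneg fun _ _ => sq_nonneg _) (hw j)
  have hm : ∀ m : ℕ, VectorBound a (8 * A + S * (1 / 2) ^ m) := by
    intro m
    induction m with
    | zero => simpa using h0
    | succ m ih =>
      convert VectorBound.improve ha ih using 1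
      ring
  intro n y w hy hw
  have hlim : Filter.Tendsto (fun m : ℕ => 8 * A + S * (1 / 2 : ℝ) ^ m) Filter.atTop
      (nhds (8 * A + S * 0)) :=
    ((tendsto_pow_atTop_nhds_zero_of_lt_one (by norm_num) (by norm_num)).const_mul S).const_add _
  simpa using ge_of_tendsto' hlim fun m => hm m n y w hy hw

theorem SignBound.nonneg {a : ι → τ → ℝ} {A : ℝ} (ha : SignBound a A) : 0 ≤ A := by
  simpa using ha 0 0 (by simp) (by simp)

theorem VectorBound.complex {a : ι → τ → ℝ} {K : ℝ} (h : VectorBound a K) {κ : Type} [Fintype κ]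
    (y : ι → κ → ℂ) (w : τ → κ → ℂ) (hy : ∀ i, ∑ k, ‖y i k‖ ^ 2 ≤ 1)
    (hw : ∀ j, ∑ k, ‖w j k‖ ^ 2 ≤ 1) : ‖∑ i, ∑ j, (a i j : ℂ) * ∑ k, y i k * w j k‖ ≤ K := by
  have hre : ∀ y : ι → κ → ℂ, (∀ i, ∑ k, ‖y i k‖ ^ 2 ≤ 1) →
      (∑ i, ∑ j, (a i j : ℂ) * ∑ k, y i k * w j k).re ≤ K := by
    intro y hy
    have := h.fintype (κ := κ ⊕ κ)
      (fun i => Sum.elim (fun k => (y i k).re) (fun k => (y i k).im))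
      (fun j => Sum.elim (fun k => (w j k).re) (fun k => -(w j k).im))
      (fun i => by
        simpa [Fintype.sum_sum_type, ← Finset.sum_add_distrib, Complex.sq_norm,
          Complex.normSq_apply, ← sq] using hy i)
      (fun i => by
        simpa [Fintype.sum_sum_type, ← Finset.sum_add_distrib, Complex.sq_norm,
          Complex.normSq_apply, ← sq] using hw i)
    simpa [Fintype.sum_sum_type, ← Finset.sum_add_distrib, ← sub_eq_add_neg] using this
  set S := ∑ i, ∑ j, (a i j : ℂ) * ∑ k, y i k * w j k with hS
  obtain ⟨c, hc, hcS⟩ : ∃ c : ℂ, ‖c‖ = 1 ∧ (‖S‖ : ℂ) = c * S := by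
    simpa using RCLike.exists_norm_eq_mul_self S
  have := hre (fun i k => c * y i k) (by simpa [hc] using hy)
  have e : ∑ i, ∑ j, (a i j : ℂ) * ∑ k, c * y i k * w j k = c * S := by
    rw [hS]
    simp only [Finset.mul_sum]
    refine Finset.sum_congr rfl fun i _ => Finset.sum_congr rfl fun j _ =>
      Finset.sum_congr rfl fun k _ => by ring
  rwa [e, ← hcS, Complex.ofReal_re] at this

theorem VectorBound.sum_abs_mul_le {a : ι → τ → ℝ} {K : ℝ} (h : VectorBound a K) (l : τ → ℝ)
    (hl : ∑ j, l j ^ 2 ≤ 1) : ∑ i, ∑ j, |a i j| * l j ≤ K := by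
  classical
  have := h.fintype (fun i k => SignType.sign (a i k) * l k) (fun j k => if j = k then 1 else 0)
    (fun i => by
      refine (Finset.sum_le_sum fun k _ => ?_).trans hl
      rw [mul_pow]
      refine mul_le_of_le_one_left (sq_nonneg _) ?_
      rcases lt_trichotomy (a i k) 0 with h | h | h <;> simp [h])
    (fun j => by simp)
  refine le_trans (le_of_eq ?_) this
  refine Finset.sum_congr rfl fun i _ => Finset.sum_congr rfl fun j _ => ?_
  simp only [mul_ite, mul_one, mul_zero, Finset.sum_ite_eq, Finset.mem_univ, if_true]
  rw [← mul_assoc, self_mul_sign]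

/-- The power `t ^ z`, as an entire function of `z`, of a positive real `t`. -/
def realPow (t : ℝ) (z : ℂ) : ℂ := Complex.exp (z * (Real.log t : ℂ))

theorem norm_realPow {t : ℝ} (ht : 0 < t) (z : ℂ) : ‖realPow t z‖ = t ^ z.re := by
  rw [realPow, Complex.norm_exp, Real.rpow_def_of_pos ht]
  simp [mul_comm]

theorem realPow_ofReal {t : ℝ} (ht : 0 < t) (x : ℝ) : realPow t x = ((t ^ x : ℝ) : ℂ) := by
  rw [realPow, Real.rpow_def_of_pos ht]
  push_cast
  rw [mul_comm]

theorem norm_realPow_eq_exp (t : ℝ) (z : ℂ) : ‖realPow t z‖ = Real.exp (z.re * Real.log t) := by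
  simp [realPow, Complex.norm_exp]

@[fun_prop]
theorem differentiable_realPow (t : ℝ) : Differentiable ℂ (realPow t) := by
  unfold realPow
  fun_prop

/-- Three lines theorem interpolation between Grothendieck's inequality and the mixed
`(ℓ_1, ℓ_2)` estimate. -/
theorem SignBound.interpolate {a : ι → τ → ℝ} {A : ℝ} (ha : SignBound a A) {κ : Type} [Fintype κ]
    {σ h : ι → κ → ℝ} {ρ g : τ → κ → ℝ} {l : τ → ℝ} {s θ : ℝ} (hs : s = 1 ∨ s = -1)
    (hθ0 : 0 ≤ θ) (hθ1 : θ ≤ 1)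
    (hσ : ∀ i k, |σ i k| ≤ 1) (hρ : ∀ j k, |ρ j k| ≤ 1)
    (hh : ∀ i k, 0 ≤ h i k) (hg : ∀ j k, 0 ≤ g j k) (hl : ∀ j, 0 ≤ l j)
    (hh0 : ∀ i k, h i k = 0 → σ i k = 0) (hg0 : ∀ j k, g j k = 0 → ρ j k = 0)
    (hl0 : ∀ j k, l j = 0 → ρ j k = 0)
    (hh2 : ∀ i, ∑ k, h i k ^ 2 ≤ 1) (hg2 : ∀ j, ∑ k, g j k ^ 2 ≤ 1) (hl2 : ∑ j, l j ^ 2 ≤ 1) :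
    ∑ i, ∑ j, a i j * ∑ k, (σ i k * h i k ^ (1 - s * θ)) *
      (ρ j k * g j k ^ (1 + s * θ) * l j ^ θ) ≤ 8 * A := by
  let Y : ℂ → ι → κ → ℂ := fun z i k => σ i k * realPow (h i k) (1 - s * z)
  let W : ℂ → τ → κ → ℂ := fun z j k =>
    ρ j k * realPow (g j k) (1 + s * z) * realPow (l j) z
  let F : ℂ → ℂ := fun z => ∑ i, ∑ j, (a i j : ℂ) * ∑ k, Y z i k * W z j k
  have hYn : ∀ z i k, ‖Y z i k‖ ≤ h i k ^ (1 - s * z.re) := by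
    intro z i k
    rcases (hh i k).eq_or_lt with h0 | h0
    · simp only [Y, hh0 i k h0.symm]; simpa using Real.rpow_nonneg (hh i k) _
    · simp only [Y, norm_mul, norm_realPow h0, Complex.norm_real]
      refine (mul_le_of_le_one_left (Real.rpow_nonneg (hh i k) _) (hσ i k)).trans_eq ?_
      simp
  have hWn : ∀ z j k, ‖W z j k‖ ≤ g j k ^ (1 + s * z.re) * l j ^ z.re := by
    intro z j k
    have hnn : 0 ≤ g j k ^ (1 + s * z.re) * l j ^ z.re :=
      mul_nonneg (Real.rpow_nonneg (hg j k) _) (Real.rpow_nonneg (hl j) _)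
    rcases (hg j k).eq_or_lt with h0 | h0
    · simpa [W, hg0 j k h0.symm] using hnn
    rcases (hl j).eq_or_lt with h1 | h1
    · simpa [W, hl0 j k h1.symm] using hnn
    simp only [W, norm_mul, norm_realPow h0, norm_realPow h1, Complex.norm_real, mul_assoc]
    refine (mul_le_of_le_one_left ?_ (hρ j k)).trans_eq ?_
    · positivity
    · simp
  have hd : Differentiable ℂ F := by
    have hY : ∀ i k, Differentiable ℂ (fun z => Y z i k) := fun i k =>
      (differentiable_const _).mul ((differentiable_realPow _).comp (by fun_prop))
    have hW : ∀ j k, Differentiable ℂ (fun z => W z j k) := fun j k =>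
      ((differentiable_const _).mul ((differentiable_realPow _).comp (by fun_prop))).mul
        (differentiable_realPow _)
    fun_prop
  have hB : BddAbove ((norm ∘ F) '' Complex.HadamardThreeLines.verticalClosedStrip 0 1) := by
    let G : ℝ → ℝ := fun x => ∑ i, ∑ j, |a i j| * ∑ k,
      (|σ i k| * Real.exp ((1 - s * x) * Real.log (h i k))) *
      (|ρ j k| * Real.exp ((1 + s * x) * Real.log (g j k)) * Real.exp (x * Real.log (l j)))
    have hG : Continuous G := by fun_prop
    obtain ⟨C, hC⟩ := (isCompact_Icc (a := (0 : ℝ)) (b := 1)).bddAbove_image hG.continuousOn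
    refine ⟨C, ?_⟩
    rintro _ ⟨z, hz, rfl⟩
    refine le_trans ?_ (hC ⟨z.re, hz, rfl⟩)
    refine (norm_sum_le _ _).trans (Finset.sum_le_sum fun i _ => ?_)
    refine (norm_sum_le _ _).trans (Finset.sum_le_sum fun j _ => ?_)
    rw [norm_mul, Complex.norm_real, Real.norm_eq_abs]
    refine mul_le_mul_of_nonneg_left ?_ (abs_nonneg _)
    refine (norm_sum_le _ _).trans (Finset.sum_le_sum fun k _ => ?_)
    simp [Y, W, norm_realPow_eq_exp]
  have hV := ha.vectorBound
  have h0 : ∀ z ∈ Complex.re ⁻¹' {0}, ‖F z‖ ≤ 8 * A := by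
    intro z hz
    have hz : z.re = 0 := hz
    refine hV.complex (Y z) (W z) (fun i => ?_) (fun j => ?_)
    · refine (Finset.sum_le_sum fun k _ => ?_).trans (hh2 i)
      exact pow_le_pow_left₀ (norm_nonneg _) (by simpa [hz] using hYn z i k) 2
    · refine (Finset.sum_le_sum fun k _ => ?_).trans (hg2 j)
      exact pow_le_pow_left₀ (norm_nonneg _) (by simpa [hz] using hWn z j k) 2
  have h1 : ∀ z ∈ Complex.re ⁻¹' {1}, ‖F z‖ ≤ 8 * A := by
    intro z hz
    have hz : z.re = 1 := hz
    refine le_trans ?_ (hV.sum_abs_mul_le l hl2)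
    refine (norm_sum_le _ _).trans (Finset.sum_le_sum fun i _ => ?_)
    refine (norm_sum_le _ _).trans (Finset.sum_le_sum fun j _ => ?_)
    rw [norm_mul, Complex.norm_real, Real.norm_eq_abs]
    refine mul_le_mul_of_nonneg_left ?_ (abs_nonneg _)
    have hterm : ∀ k, ‖Y z i k * W z j k‖ ≤
        h i k ^ (1 - s) * (g j k ^ (1 + s) * l j) := by
      intro k
      rw [norm_mul]
      refine mul_le_mul ?_ ?_ (norm_nonneg _) (Real.rpow_nonneg (hh i k) _)
      · simpa [hz] using hYn z i k
      · simpa [hz] using hWn z j k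
    refine (norm_sum_le _ _).trans ((Finset.sum_le_sum fun k _ => hterm k).trans ?_)
    simp only [← mul_assoc, ← Finset.sum_mul]
    refine mul_le_of_le_one_left (hl j) ?_
    rcases hs with rfl | rfl
    · norm_num
      exact hg2 j
    · norm_num
      exact hh2 i
  have key := Complex.HadamardThreeLines.norm_le_interp_of_mem_verticalClosedStrip₀₁' F
    (z := (θ : ℂ)) (a := 8 * A) (b := 8 * A) ⟨by simpa using hθ0, by simpa using hθ1⟩
    hd.diffContOnCl hB h0 h1
  have hA : 0 ≤ 8 * A := by linarith [ha.nonneg]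
  rw [← Real.rpow_add_of_nonneg hA (by simpa using hθ1) (by simpa using hθ0),
    sub_add_cancel, Real.rpow_one] at key
  have hY : ∀ i k, Y θ i k = ((σ i k * h i k ^ (1 - s * θ) : ℝ) : ℂ) := by
    intro i k
    rcases (hh i k).eq_or_lt with h0 | h0
    · simp [Y, hh0 i k h0.symm]
    · have := realPow_ofReal h0 (1 - s * θ)
      push_cast at this ⊢
      simp [Y, this]
  have hW : ∀ j k, W θ j k = ((ρ j k * g j k ^ (1 + s * θ) * l j ^ θ : ℝ) : ℂ) := by
    intro j k
    rcases (hg j k).eq_or_lt with h0 | h0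
    · simp [W, hg0 j k h0.symm]
    rcases (hl j).eq_or_lt with h1 | h1
    · simp [W, hl0 j k h1.symm]
    have := realPow_ofReal h0 (1 + s * θ)
    have h2 := realPow_ofReal h1 θ
    push_cast at this h2 ⊢
    simp [W, this, h2]
  have hF : F θ = ((∑ i, ∑ j, a i j * ∑ k, (σ i k * h i k ^ (1 - s * θ)) *
      (ρ j k * g j k ^ (1 + s * θ) * l j ^ θ) : ℝ) : ℂ) := by
    simp only [F, hY, hW]
    push_cast
    rfl
  rw [hF, Complex.norm_real] at key
  exact (le_abs_self _).trans key

theorem SignBound.sum_norm_rpow_le {a : ι → τ → ℝ} {A : ℝ} (ha : SignBound a A) {κ : Type}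
    [Fintype κ] {p : ℝ} (hp : 1 ≤ p) (y : ι → κ → ℝ) (hy : ∀ i, ∑ k, |y i k| ^ p ≤ 1) :
    ∑ j, ((∑ k, |∑ i, a i j * y i k| ^ p) ^ (1 / p)) ^ (1 / (1 - |1 / p - 1 / 2|)) ≤
      (8 * A) ^ (1 / (1 - |1 / p - 1 / 2|)) := by
  have hp0 : 0 < p := by linarith
  have hip0 : 0 < 1 / p := by positivity
  have hip1 : 1 / p ≤ 1 := by rw [div_le_one hp0]; exact hp
  obtain ⟨θ, hθ⟩ : ∃ θ, θ = |1 - 2 / p| := ⟨_, rfl⟩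
  have h2p : 2 / p = 2 * (1 / p) := by ring
  have hθ0 : 0 ≤ θ := hθ ▸ abs_nonneg _
  have hθ1 : θ ≤ 1 := by rw [hθ, abs_le]; constructor <;> linarith
  obtain ⟨s, hs, hsθ⟩ : ∃ s : ℝ, (s = 1 ∨ s = -1) ∧ s * θ = 1 - 2 / p := by
    rcases le_total 0 (1 - 2 / p) with h | h
    · exact ⟨1, Or.inl rfl, by rw [hθ, abs_of_nonneg h, one_mul]⟩
    · exact ⟨-1, Or.inr rfl, by rw [hθ, abs_of_nonpos h]; ring⟩
  have habs : |1 / p - 1 / 2| = θ / 2 := by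
    rw [hθ, h2p, show 1 / p - 1 / 2 = -((1 - 2 * (1 / p)) / 2) by ring, abs_neg, abs_div, abs_two]
  rw [habs]
  obtain ⟨r, hr⟩ : ∃ r, r = 1 / (1 - θ / 2) := ⟨_, rfl⟩
  have hr0 : 0 < r := by rw [hr]; apply one_div_pos.2; linarith
  have hrθ : r * (θ / 2) = r - 1 := by
    have : 1 - θ / 2 ≠ 0 := by linarith
    have h1 : r * (1 - θ / 2) = 1 := by rw [hr]; exact one_div_mul_cancel this
    linarith
  rw [← hr]
  set v : τ → κ → ℝ := fun j k => ∑ i, a i j * y i k with hv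
  set N : τ → ℝ := fun j => (∑ k, |v j k| ^ p) ^ (1 / p) with hN
  change ∑ j, N j ^ r ≤ (8 * A) ^ r
  have hsum0 : ∀ j, 0 ≤ ∑ k, |v j k| ^ p := fun j =>
    Finset.sum_nonneg fun k _ => Real.rpow_nonneg (abs_nonneg _) _
  have hN0 : ∀ j, 0 ≤ N j := fun j => Real.rpow_nonneg (hsum0 j) _
  have hNp : ∀ j, ∑ k, |v j k| ^ p = N j ^ p := fun j => by
    rw [hN]
    simp only
    rw [← Real.rpow_mul (hsum0 j), one_div_mul_cancel hp0.ne', Real.rpow_one]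
  have hNv : ∀ j, N j = 0 → ∀ k, v j k = 0 := by
    intro j hj k
    have h1 := hNp j
    rw [hj, Real.zero_rpow hp0.ne',
      Finset.sum_eq_zero_iff_of_nonneg fun k _ => Real.rpow_nonneg (abs_nonneg _) _] at h1
    have := h1 k (Finset.mem_univ k)
    rw [Real.rpow_eq_zero (abs_nonneg _) hp0.ne'] at this
    exact abs_eq_zero.1 this
  set S : ℝ := ∑ j, N j ^ r with hS
  have hS0 : 0 ≤ S := Finset.sum_nonneg fun j _ => Real.rpow_nonneg (hN0 j) _
  rcases hS0.eq_or_lt with hS0' | hSpos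
  · rw [← hS0']; exact Real.rpow_nonneg (by linarith [ha.nonneg]) _
  have hsign : ∀ x : ℝ, |((SignType.sign x : SignType) : ℝ)| ≤ 1 := by
    intro x
    rcases lt_trichotomy x 0 with h | h | h <;> simp [h]
  have key := ha.interpolate (κ := κ) (σ := fun i k => SignType.sign (y i k))
    (h := fun i k => |y i k| ^ (p / 2)) (ρ := fun j k => SignType.sign (v j k))
    (g := fun j k => (|v j k| / N j) ^ (p / 2)) (l := fun j => (N j ^ r / S) ^ (1 / 2 : ℝ))
    hs hθ0 hθ1 (fun i k => hsign _) (fun j k => hsign _)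
    (fun i k => Real.rpow_nonneg (abs_nonneg _) _)
    (fun j k => Real.rpow_nonneg (div_nonneg (abs_nonneg _) (hN0 j)) _)
    (fun j => Real.rpow_nonneg (div_nonneg (Real.rpow_nonneg (hN0 j) _) hS0) _)
    (fun i k h => by
      rw [Real.rpow_eq_zero (abs_nonneg _) (by positivity), abs_eq_zero] at h
      simp [h])
    (fun j k h => by
      rw [Real.rpow_eq_zero (div_nonneg (abs_nonneg _) (hN0 j)) (by positivity),
        div_eq_zero_iff, abs_eq_zero] at h
      have : v j k = 0 := h.elim id fun h => hNv j h k
      simp [this])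
    (fun j k h => by
      rw [Real.rpow_eq_zero (div_nonneg (Real.rpow_nonneg (hN0 j) _) hS0) (by norm_num),
        div_eq_zero_iff, or_iff_left hSpos.ne', Real.rpow_eq_zero (hN0 j) hr0.ne'] at h
      simp [hNv j h k])
    (fun i => by
      refine le_trans (le_of_eq ?_) (hy i)
      refine Finset.sum_congr rfl fun k _ => ?_
      rw [← Real.rpow_natCast, ← Real.rpow_mul (abs_nonneg _)]
      congr 1; push_cast; ring)
    (fun j => by
      have h1 : ∀ k, ((|v j k| / N j) ^ (p / 2)) ^ 2 = |v j k| ^ p / N j ^ p := by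
        intro k
        rw [← Real.rpow_natCast, ← Real.rpow_mul (div_nonneg (abs_nonneg _) (hN0 j)),
          ← Real.div_rpow (abs_nonneg _) (hN0 j)]
        congr 1; push_cast; ring
      simp only [h1, ← Finset.sum_div]
      rw [hNp]
      exact div_self_le_one _)
    (by
      have h1 : ∀ j, ((N j ^ r / S) ^ (1 / 2 : ℝ)) ^ 2 = N j ^ r / S := by
        intro j
        rw [← Real.sqrt_eq_rpow, Real.sq_sqrt (div_nonneg (Real.rpow_nonneg (hN0 j) _) hS0)]
      simp only [h1, ← Finset.sum_div]
      exact div_self_le_one _)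
  have eY : ∀ i k, (SignType.sign (y i k) : ℝ) * (|y i k| ^ (p / 2)) ^ (1 - s * θ) = y i k := by
    intro i k
    rw [hsθ, ← Real.rpow_mul (abs_nonneg _),
      show p / 2 * (1 - (1 - 2 / p)) = 1 by field_simp; ring, Real.rpow_one, sign_mul_abs]
  have eV : ∀ j, ∑ k, v j k * ((SignType.sign (v j k) : ℝ) *
      ((|v j k| / N j) ^ (p / 2)) ^ (1 + s * θ)) = N j := by
    intro j
    rcases (hN0 j).eq_or_lt with h0 | h0
    · rw [← h0]
      exact Finset.sum_eq_zero fun k _ => by rw [hNv j h0.symm k, zero_mul]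
    have h1 : ∀ k, v j k * ((SignType.sign (v j k) : ℝ) *
      ((|v j k| / N j) ^ (p / 2)) ^ (1 + s * θ)) = |v j k| ^ p / N j ^ (p - 1) := by
      intro k
      rw [← mul_assoc, self_mul_sign, hsθ, ← Real.rpow_mul (div_nonneg (abs_nonneg _) h0.le),
        show p / 2 * (1 + (1 - 2 / p)) = p - 1 by field_simp; ring,
        Real.div_rpow (abs_nonneg _) h0.le, mul_div_assoc']
      congr 1
      rcases (abs_nonneg (v j k)).eq_or_lt with h2 | h2
      · rw [← h2, zero_mul, Real.zero_rpow hp0.ne']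
      · rw [Real.rpow_sub_one h2.ne']; field_simp
    simp only [h1, ← Finset.sum_div]
    rw [hNp, ← Real.rpow_sub h0, sub_sub_cancel, Real.rpow_one]
  have eL : ∀ j, N j * ((N j ^ r / S) ^ (1 / 2 : ℝ)) ^ θ = N j ^ r / S ^ (θ / 2) := by
    intro j
    rw [← Real.rpow_mul (div_nonneg (Real.rpow_nonneg (hN0 j) _) hS0),
      show (1 / 2 : ℝ) * θ = θ / 2 by ring,
      Real.div_rpow (Real.rpow_nonneg (hN0 j) _) hS0, ← Real.rpow_mul (hN0 j), hrθ, mul_div_assoc']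
    congr 1
    rcases (hN0 j).eq_or_lt with h2 | h2
    · rw [← h2, zero_mul, Real.zero_rpow hr0.ne']
    · rw [Real.rpow_sub_one h2.ne']; field_simp
  have etot : ∑ i, ∑ j, a i j * ∑ k,
      ((SignType.sign (y i k) : ℝ) * (|y i k| ^ (p / 2)) ^ (1 - s * θ)) *
      ((SignType.sign (v j k) : ℝ) * ((|v j k| / N j) ^ (p / 2)) ^ (1 + s * θ) *
        ((N j ^ r / S) ^ (1 / 2 : ℝ)) ^ θ) = S / S ^ (θ / 2) := by
    rw [Finset.sum_comm]
    rw [hS, Finset.sum_div, ← hS]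
    refine Finset.sum_congr rfl fun j _ => ?_
    rw [← eL j]
    have e2 := congrArg (fun x => x * ((N j ^ r / S) ^ (1 / 2 : ℝ)) ^ θ) (eV j)
    simp only [Finset.sum_mul] at e2
    rw [← e2]
    simp only [eY, Finset.mul_sum]
    rw [Finset.sum_comm]
    refine Finset.sum_congr rfl fun k _ => ?_
    simp only [hv, Finset.sum_mul]
    refine Finset.sum_congr rfl fun i _ => ?_
    ring
  rw [etot] at key
  have e1 : S / S ^ (θ / 2) = S ^ (1 / r) := by
    nth_rewrite 1 [← Real.rpow_one S]
    rw [← Real.rpow_sub hSpos, hr, one_div_one_div]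
  rw [e1] at key
  calc S = (S ^ (1 / r)) ^ r := by
        rw [← Real.rpow_mul hS0, one_div_mul_cancel hr0.ne', Real.rpow_one]
    _ ≤ _ := Real.rpow_le_rpow (Real.rpow_nonneg hS0 _) key hr0.le

end

theorem WeaklySummable.exists_norm_sum_le_s11 {E : Type*} [NormedAddCommGroup E] [NormedSpace ℝ E]
    {x : ℕ → E} (hx : WeaklySummable 1 x) :
    ∃ A, ∀ (n : ℕ) (t : Fin n → ℝ), (∀ j, |t j| ≤ 1) → ‖∑ j, t j • x j‖ ≤ A := by
  let I := Σ n : ℕ, {t : Fin n → ℝ // ∀ j, |t j| ≤ 1}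
  obtain ⟨A, hA⟩ := banach_steinhaus (𝕜 := ℝ) (𝕜₂ := ℝ) (E := StrongDual ℝ E) (F := ℝ) (ι := I)
    (g := fun i => NormedSpace.inclusionInDoubleDual ℝ E (∑ j, i.2.1 j • x j)) (by
      intro φ
      refine ⟨∑' j, |φ (x j)|, ?_⟩
      rintro ⟨n, t, ht⟩
      have hs : Summable fun j => |φ (x j)| := by simpa using hx φ
      rw [NormedSpace.dual_def]
      simp only [map_sum, map_smul, smul_eq_mul]
      calc ‖∑ j, t j * φ (x j)‖ ≤ ∑ j : Fin n, |φ (x j)| := by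
            refine (norm_sum_le _ _).trans (Finset.sum_le_sum fun j _ => ?_)
            rw [norm_mul]
            exact mul_le_of_le_one_left (abs_nonneg _) (ht j)
        _ = ∑ j ∈ Finset.range n, |φ (x j)| :=
            Fin.sum_univ_eq_sum_range (fun j => |φ (x j)|) n
        _ ≤ _ := hs.sum_le_tsum _ fun _ _ => abs_nonneg _)
  refine ⟨A, fun n t ht => ?_⟩
  rw [← (NormedSpace.inclusionInDoubleDualLi ℝ (E := E)).norm_map]
  exact hA ⟨n, t, ht⟩

theorem absolutelySumming_of_ne_top (p : ℝ≥0∞) [hp : Fact (1 ≤ p)] (hp' : p ≠ ⊤)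
    (u : lp (fun _ : ℕ => ℝ) 1 →L[ℝ] lp (fun _ : ℕ => ℝ) p) :
    AbsolutelySumming (1 / (1 - |1 / p.toReal - 1 / 2|)) 1 u := by
  intro x hx
  obtain ⟨A, hA⟩ := hx.exists_norm_sum_le_s11
  set r : ℝ := 1 / (1 - |1 / p.toReal - 1 / 2|) with hr
  have hq : 1 ≤ p.toReal := by
    rw [← ENNReal.toReal_one]; exact ENNReal.toReal_mono hp' hp.out
  have hq0 : 0 < p.toReal := by linarith
  have hr0 : 0 ≤ r := by
    have h0 : 0 < 1 / p.toReal := by positivity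
    have h1 : 1 / p.toReal ≤ 1 := by rw [div_le_one hq0]; exact hq
    have : |1 / p.toReal - 1 / 2| ≤ 1 / 2 := by rw [abs_le]; constructor <;> linarith
    apply one_div_nonneg.2; linarith
  obtain ⟨B, hB0, hB⟩ : ∃ B : ℝ, 0 < B ∧ ‖u‖ ≤ B := ⟨‖u‖ + 1, by positivity, by linarith⟩
  have hsign : ∀ n m : ℕ, SignBound (fun (i : Fin m) (j : Fin n) => B * x j i) (B * A) := by
    intro n m s t hs ht
    have h1 := hA n t ht
    have h2 := lp.sum_rpow_le_norm_rpow (by simp) (∑ j, t j • x j) (Finset.range m)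
    simp only [ENNReal.toReal_one, Real.rpow_one] at h2
    rw [← Fin.sum_univ_eq_sum_range (fun i => ‖(∑ j, t j • x j : lp (fun _ : ℕ => ℝ) 1) i‖)] at h2
    have h3 : ∑ i : Fin m, ∑ j : Fin n, B * x j i * (s i * t j) ≤
        B * ∑ i : Fin m, ‖(∑ j, t j • x j : lp (fun _ : ℕ => ℝ) 1) i‖ := by
      rw [Finset.mul_sum]
      refine Finset.sum_le_sum fun i _ => ?_
      have : ∑ j : Fin n, B * x j i * (s i * t j) =
          B * (s i * (∑ j, t j • x j : lp (fun _ : ℕ => ℝ) 1) i) := by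
        rw [lp.coeFn_sum, Finset.sum_apply, Finset.mul_sum, Finset.mul_sum]
        refine Finset.sum_congr rfl fun j _ => ?_
        simp only [lp.coeFn_smul, Pi.smul_apply, smul_eq_mul]
        ring
      rw [this]
      refine mul_le_mul_of_nonneg_left ?_ hB0.le
      refine (le_abs_self _).trans ?_
      rw [abs_mul]
      exact mul_le_of_le_one_left (abs_nonneg _) (hs i)
    refine h3.trans (mul_le_mul_of_nonneg_left (h2.trans h1) hB0.le)
  let e : ℕ → lp (fun _ : ℕ => ℝ) 1 := fun i => lp.single 1 i (1 : ℝ)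
  have hy : ∀ N i : ℕ, ∑ k : Fin N, |u (e i) k / B| ^ p.toReal ≤ 1 := by
    intro N i
    have h1 := lp.sum_rpow_le_norm_rpow hq0 (u (e i)) (Finset.range N)
    rw [← Fin.sum_univ_eq_sum_range (fun k => ‖u (e i) k‖ ^ p.toReal)] at h1
    have h2 : ‖u (e i)‖ ≤ B := by
      refine (u.le_opNorm _).trans ?_
      rw [lp.norm_single (by simp)]
      simpa using hB
    simp only [abs_div, abs_of_pos hB0, Real.div_rpow (abs_nonneg _) hB0.le, ← Finset.sum_div]
    rw [div_le_one (by positivity)]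
    exact h1.trans (Real.rpow_le_rpow (norm_nonneg _) h2 hq0.le)
  have hfin : ∀ n N m : ℕ, ∑ j : Fin n,
      ((∑ k : Fin N, |∑ i : Fin m, x j i * u (e i) k| ^ p.toReal) ^ (1 / p.toReal)) ^ r ≤
      (8 * (B * A)) ^ r := by
    intro n N m
    have := (hsign n m).sum_norm_rpow_le hq (fun i (k : Fin N) => u (e i) k / B)
      (fun i => hy N i)
    have e1 : ∀ (i : Fin m) (j : Fin n) (k : Fin N), B * x j i * (u (e i) k / B) =
        x j i * u (e i) k := fun i j k => by field_simp
    simpa only [e1] using this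
  have hlim1 : ∀ (j k : ℕ), Filter.Tendsto (fun m : ℕ => ∑ i : Fin m, x j i * u (e i) k)
      Filter.atTop (nhds (u (x j) k)) := by
    intro j k
    have h1 := lp.hasSum_single ENNReal.one_ne_top (x j)
    have h2 := (h1.mapL u).mapL (lp.evalCLM ℝ (fun _ : ℕ => ℝ) p k)
    have h3 := h2.tendsto_sum_nat
    refine h3.congr fun m => ?_
    rw [← Fin.sum_univ_eq_sum_range]
    refine Finset.sum_congr rfl fun i _ => ?_
    have : lp.single (E := fun _ : ℕ => ℝ) 1 (i : ℕ) (x j i) = x j i • e i := by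
      rw [← lp.single_smul, smul_eq_mul, mul_one]
    rw [this, map_smul, map_smul]
    rfl
  have hfin2 : ∀ n N : ℕ, ∑ j : Fin n,
      ((∑ k : Fin N, |u (x j) k| ^ p.toReal) ^ (1 / p.toReal)) ^ r ≤ (8 * (B * A)) ^ r := by
    intro n N
    refine le_of_tendsto' (x := Filter.atTop) (tendsto_finsetSum _ fun j _ => ?_) (hfin n N)
    refine Filter.Tendsto.rpow_const (Filter.Tendsto.rpow_const
      (tendsto_finsetSum _ fun k _ => ?_) (Or.inr (by positivity))) (Or.inr hr0)
    exact ((hlim1 j k).abs).rpow_const (Or.inr hq0.le)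
  have hfin3 : ∀ n : ℕ, ∑ j ∈ Finset.range n, ‖u (x j)‖ ^ r ≤ (8 * (B * A)) ^ r := by
    intro n
    rw [← Fin.sum_univ_eq_sum_range (fun j => ‖u (x j)‖ ^ r)]
    refine le_of_tendsto' (x := Filter.atTop) (tendsto_finsetSum _ fun j _ => ?_) (hfin2 n)
    refine Filter.Tendsto.rpow_const ?_ (Or.inr hr0)
    rw [lp.norm_eq_tsum_rpow hq0]
    refine Filter.Tendsto.rpow_const ?_ (Or.inr (by positivity))
    have h := (lp.hasSum_norm hq0 (u (x j))).tendsto_sum_nat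
    rw [← lp.norm_rpow_eq_tsum hq0]
    refine h.congr fun N => ?_
    rw [← Fin.sum_univ_eq_sum_range (fun k => ‖u (x j) k‖ ^ p.toReal)]
    rfl
  exact summable_of_sum_range_le (fun j => Real.rpow_nonneg (norm_nonneg _) _) hfin3

theorem absolutelySumming_top {p : ℝ≥0∞} [Fact (1 ≤ p)]
    (u : lp (fun _ : ℕ => ℝ) 1 →L[ℝ] lp (fun _ : ℕ => ℝ) p) : AbsolutelySumming 2 1 u := by
  intro x hx
  have h := absolutelySumming_of_ne_top 1 ENNReal.one_ne_top (ContinuousLinearMap.id ℝ _) x hx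
  have e : (1 / (1 - |1 / (1 : ℝ≥0∞).toReal - 1 / 2|) : ℝ) = 2 := by
    rw [ENNReal.toReal_one, abs_of_pos] <;> norm_num
  rw [e] at h
  refine Summable.of_nonneg_of_le (fun j => by positivity) (fun j => ?_) (h.mul_left (‖u‖ ^ (2:ℝ)))
  rw [← Real.mul_rpow (norm_nonneg _) (norm_nonneg _)]
  exact Real.rpow_le_rpow (norm_nonneg _) (u.le_opNorm _) (by norm_num)

theorem absolutelySumming (p : ℝ≥0∞) [Fact (1 ≤ p)]
    (u : lp (fun _ : ℕ => ℝ) 1 →L[ℝ] lp (fun _ : ℕ => ℝ) p) :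
    AbsolutelySumming (1 / (1 - |(1 / p).toReal - 1 / 2|)) 1 u := by
  by_cases hp : p = ⊤
  · subst hp
    have e : (1 / (1 - |(1 / (⊤ : ℝ≥0∞)).toReal - 1 / 2|) : ℝ) = 2 := by
      rw [ENNReal.div_top, ENNReal.toReal_zero, abs_of_neg] <;> norm_num
    rw [e]
    exact absolutelySumming_top u
  · have := absolutelySumming_of_ne_top p hp u
    rwa [ENNReal.toReal_div, ENNReal.toReal_one]

/-- The Walsh matrix of order `2 ^ m`. -/
def walsh {m : ℕ} (i k : Fin m → Bool) : ℝ := ∏ l, if i l && k l then -1 else 1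

theorem walsh_comm {m : ℕ} (i k : Fin m → Bool) : walsh i k = walsh k i := by
  simp [walsh, Bool.and_comm]

theorem abs_walsh {m : ℕ} (i k : Fin m → Bool) : |walsh i k| = 1 := by
  rw [walsh, Finset.abs_prod]
  exact Finset.prod_eq_one fun l _ => by split_ifs <;> simp

theorem sum_walsh_mul_walsh {m : ℕ} (i j : Fin m → Bool) :
    ∑ k, walsh i k * walsh j k = if i = j then 2 ^ m else 0 := by
  simp only [walsh, ← Finset.prod_mul_distrib]
  rw [← Fintype.prod_sum
    (fun l (b : Bool) => (if i l && b then (-1 : ℝ) else 1) * if j l && b then -1 else 1)]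
  split_ifs with h
  · subst h
    rw [Finset.prod_eq_pow_card (b := 2)]
    · simp
    · intro l _
      cases i l <;> norm_num
  · obtain ⟨l, hl⟩ := Function.ne_iff.1 h
    refine Finset.prod_eq_zero (Finset.mem_univ l) ?_
    revert hl
    cases i l <;> cases j l <;> simp

theorem sum_walsh_sum_sq {m : ℕ} (f : (Fin m → Bool) → ℝ) :
    ∑ j, (∑ k, walsh j k * f k) ^ 2 = 2 ^ m * ∑ k, f k ^ 2 := by
  have h1 : ∀ j, (∑ k, walsh j k * f k) ^ 2 =
      ∑ k, ∑ l, f k * f l * (walsh k j * walsh l j) := by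
    intro j
    rw [sq, Finset.sum_mul_sum]
    refine Finset.sum_congr rfl fun k _ => Finset.sum_congr rfl fun l _ => ?_
    rw [walsh_comm j k, walsh_comm j l]; ring
  simp only [h1]
  rw [Finset.sum_comm, Finset.mul_sum]
  refine Finset.sum_congr rfl fun k _ => ?_
  rw [Finset.sum_comm]
  simp only [← Finset.mul_sum, sum_walsh_mul_walsh]
  simp
  ring

/-- The operator on `ℓ_1` sending the unit vectors to a given bounded sequence. -/
theorem exists_clm_of_bounded {E : Type*} [NormedAddCommGroup E] [NormedSpace ℝ E]
    [CompleteSpace E] (y : ℕ → E) (hy : ∀ i, ‖y i‖ ≤ 1) :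
    ∃ u : lp (fun _ : ℕ => ℝ) 1 →L[ℝ] E, ∀ i, u (lp.single 1 i (1 : ℝ)) = y i := by
  have hn : ∀ x : lp (fun _ : ℕ => ℝ) 1, HasSum (fun i => ‖x i‖) ‖x‖ := fun x => by
    simpa using lp.hasSum_norm (by simp) x
  have hle : ∀ (x : lp (fun _ : ℕ => ℝ) 1) i, ‖x i • y i‖ ≤ ‖x i‖ := fun x i => by
    rw [norm_smul]; exact mul_le_of_le_one_right (norm_nonneg _) (hy i)
  have hs : ∀ x : lp (fun _ : ℕ => ℝ) 1, Summable fun i => x i • y i := fun x =>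
    Summable.of_norm_bounded (hn x).summable (hle x)
  let L : lp (fun _ : ℕ => ℝ) 1 →ₗ[ℝ] E :=
    { toFun := fun x => ∑' i, x i • y i
      map_add' := fun x z => by
        simp only [lp.coeFn_add, Pi.add_apply, add_smul]
        exact (hs x).tsum_add (hs z)
      map_smul' := fun c x => by
        simp only [lp.coeFn_smul, Pi.smul_apply, smul_assoc, RingHom.id_apply]
        exact (hs x).tsum_const_smul c }
  refine ⟨L.mkContinuous 1 fun x => ?_, fun i => ?_⟩
  · rw [one_mul]
    exact tsum_of_norm_bounded (hn x) (hle x)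
  · change ∑' k, lp.single (E := fun _ : ℕ => ℝ) 1 i (1 : ℝ) k • y k = y i
    rw [tsum_eq_single i fun k hk => by rw [lp.single_apply_ne _ _ _ hk, zero_smul],
      lp.single_apply_self, one_smul]

/-- The index set of a sequence of blocks, the `m`-th of them having `2 ^ m` elements. -/
abbrev BlockIndex : Type := Σ m : ℕ, (Fin m → Bool)

/-- The vector in `ℓ_p` supported on a block, with entries a row of the Walsh matrix. -/
def walshVector (e : BlockIndex ≃ ℕ) (p : ℝ≥0∞) (t : BlockIndex) : lp (fun _ : ℕ => ℝ) p :=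
  ∑ k, lp.single p (e ⟨t.1, k⟩) (walsh t.2 k)

theorem block_injective (e : BlockIndex ≃ ℕ) (m : ℕ) :
    Function.Injective fun k : Fin m → Bool => e ⟨m, k⟩ := fun _ _ h => by
  simpa using e.injective h

theorem norm_walshVector (e : BlockIndex ≃ ℕ) {p : ℝ≥0∞} [hp : Fact (1 ≤ p)] (hp' : p ≠ ⊤)
    (t : BlockIndex) : ‖walshVector e p t‖ = ((2 : ℝ) ^ t.1) ^ (1 / p.toReal) := by
  have hq : 0 < p.toReal := ENNReal.toReal_pos (zero_lt_one.trans_le hp.out).ne' hp'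
  obtain ⟨m, j⟩ := t
  let f : ℕ → ℝ := fun n => ∑ k, if e ⟨m, k⟩ = n then walsh j k else 0
  have hf : ∀ k, f (e ⟨m, k⟩) = walsh j k := fun k => by
    simp only [f]
    rw [Finset.sum_eq_single k]
    · simp
    · intro l _ hl
      rw [if_neg fun h => hl (block_injective e m h)]
    · simp
  have h := lp.norm_sum_single (E := fun _ : ℕ => ℝ) hq f
    (Finset.univ.map ⟨_, block_injective e m⟩)
  simp only [Finset.sum_map, Function.Embedding.coeFn_mk, hf, Real.norm_eq_abs, abs_walsh,
    Real.one_rpow] at h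
  have h' : ‖walshVector e p ⟨m, j⟩‖ ^ p.toReal = 2 ^ m := by
    rw [walshVector, h]; simp
  rw [← h', ← Real.rpow_mul (norm_nonneg _), mul_one_div_cancel hq.ne', Real.rpow_one]

theorem norm_walshVector_le (e : BlockIndex ≃ ℕ) {p : ℝ≥0∞} [hp : Fact (1 ≤ p)]
    (t : BlockIndex) : ‖walshVector e p t‖ ≤ ((2 : ℝ) ^ t.1) ^ (1 / p).toReal := by
  by_cases hp' : p = ⊤
  · subst hp'
    obtain ⟨m, j⟩ := t
    simp only [ENNReal.div_top, ENNReal.toReal_zero, Real.rpow_zero]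
    refine lp.norm_le_of_forall_le zero_le_one fun n => ?_
    rw [walshVector, lp.coeFn_sum, Finset.sum_apply]
    simp only [lp.single_apply, Pi.single_apply]
    by_cases hn : ∃ k, n = e ⟨m, k⟩
    · obtain ⟨k, rfl⟩ := hn
      rw [Finset.sum_eq_single k]
      · simp [abs_walsh]
      · intro l _ hl
        rw [if_neg fun h => hl (block_injective e m h.symm)]
      · simp
    · rw [Finset.sum_eq_zero]
      · simp
      · intro k _
        rw [if_neg fun h => hn ⟨k, h⟩]
  · rw [norm_walshVector e hp', ENNReal.toReal_div, ENNReal.toReal_one]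

theorem map_walshVector (e : BlockIndex ≃ ℕ) {E : Type*} [NormedAddCommGroup E] [NormedSpace ℝ E]
    (u : lp (fun _ : ℕ => ℝ) 1 →L[ℝ] E) (t : BlockIndex) :
    u (walshVector e 1 t) = ∑ k, walsh t.2 k • u (lp.single 1 (e ⟨t.1, k⟩) (1 : ℝ)) := by
  rw [walshVector, map_sum]
  refine Finset.sum_congr rfl fun k _ => ?_
  rw [← map_smul, ← lp.single_smul, smul_eq_mul, mul_one]

theorem sum_abs_map_walshVector_le (e : BlockIndex ≃ ℕ)
    (φ : lp (fun _ : ℕ => ℝ) 1 →L[ℝ] ℝ) (m : ℕ) :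
    ∑ j, |φ (walshVector e 1 ⟨m, j⟩)| ≤ ((2 : ℝ) ^ m) ^ (3 / 2 : ℝ) * ‖φ‖ := by
  set N : ℝ := 2 ^ m with hN
  have hN0 : 0 < N := by positivity
  have hcard : ((Finset.univ : Finset (Fin m → Bool)).card : ℝ) = N := by simp [hN]
  have hφ : ∀ k : Fin m → Bool, φ (lp.single 1 (e ⟨m, k⟩) (1 : ℝ)) ^ 2 ≤ ‖φ‖ ^ 2 := by
    intro k
    rw [sq_le_sq, abs_norm]
    have := φ.le_opNorm (lp.single 1 (e ⟨m, k⟩) (1 : ℝ))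
    rwa [lp.norm_single (by simp), norm_one, mul_one] at this
  refine abs_le_of_sq_le_sq' (a := ∑ j, |φ (walshVector e 1 ⟨m, j⟩)|) ?_ (by positivity) |>.2
  calc (∑ j, |φ (walshVector e 1 ⟨m, j⟩)|) ^ 2
      ≤ N * ∑ j, |φ (walshVector e 1 ⟨m, j⟩)| ^ 2 := by
        rw [← hcard]; exact sq_sum_le_card_mul_sum_sq
    _ = N * (N * ∑ k, φ (lp.single 1 (e ⟨m, k⟩) (1 : ℝ)) ^ 2) := by
        simp only [sq_abs, map_walshVector, smul_eq_mul]
        rw [sum_walsh_sum_sq]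
    _ ≤ N * (N * (N * ‖φ‖ ^ 2)) := by
        gcongr
        refine (Finset.sum_le_sum fun k _ => hφ k).trans_eq ?_
        rw [Finset.sum_const, nsmul_eq_mul, hcard]
    _ = (N ^ (3 / 2 : ℝ) * ‖φ‖) ^ 2 := by
        rw [mul_pow, ← Real.rpow_natCast (N ^ (3 / 2 : ℝ)), ← Real.rpow_mul hN0.le]
        norm_num
        ring

theorem not_absolutelySumming_of_norm_eq (e : BlockIndex ≃ ℕ) {E : Type*} [NormedAddCommGroup E]
    [NormedSpace ℝ E] (u : lp (fun _ : ℕ => ℝ) 1 →L[ℝ] E) {d r : ℝ} (hr : 0 < r) (hd : d < 1 / r)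
    (hu : ∀ t : BlockIndex, ‖u (walshVector e 1 t)‖ = ((2 : ℝ) ^ t.1) ^ (3 / 2 - d)) :
    ¬ AbsolutelySumming r 1 u := by
  intro h
  let x : BlockIndex → lp (fun _ : ℕ => ℝ) 1 := fun t =>
    ((2 : ℝ) ^ t.1) ^ (d - 1 / r - 3 / 2) • walshVector e 1 t
  have hx : WeaklySummable 1 fun n => x (e.symm n) := by
    intro φ
    simp only [Real.rpow_one]
    refine (e.symm.summable_iff (f := fun t => |φ (x t)|)).2 ?_
    rw [summable_sigma_of_nonneg fun t => abs_nonneg _]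
    refine ⟨fun m => Summable.of_finite, ?_⟩
    have hgeo : Summable fun m : ℕ => ((2 : ℝ) ^ (d - 1 / r)) ^ m * ‖φ‖ := by
      refine (summable_geometric_of_lt_one (by positivity) ?_).mul_right _
      exact Real.rpow_lt_one_of_one_lt_of_neg (by norm_num) (by linarith)
    refine Summable.of_nonneg_of_le (fun m => tsum_nonneg fun _ => abs_nonneg _) (fun m => ?_) hgeo
    rw [tsum_fintype]
    simp only [x, map_smul, smul_eq_mul, abs_mul, ← Finset.mul_sum]
    rw [abs_of_nonneg (by positivity)]
    refine (mul_le_mul_of_nonneg_left (sum_abs_map_walshVector_le e φ m) (by positivity)).trans_eq ?_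
    rw [← mul_assoc, ← Real.rpow_add (by positivity), sub_add_cancel, ← Real.rpow_natCast,
      ← Real.rpow_natCast, ← Real.rpow_mul (by norm_num), ← Real.rpow_mul (by norm_num),
      mul_comm (m : ℝ)]
  have h1 := (e.symm.summable_iff (f := fun t => ‖u (x t)‖ ^ r)).1 (h _ hx)
  have h2 : ∀ t, ‖u (x t)‖ ^ r = ((2 : ℝ) ^ t.1)⁻¹ := by
    intro t
    simp only [x, map_smul, norm_smul, hu]
    rw [Real.norm_of_nonneg (by positivity), ← Real.rpow_add (by positivity),
      ← Real.rpow_mul (by positivity), ← Real.rpow_neg_one]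
    congr 1
    field_simp
    ring
  simp only [h2] at h1
  have h3 := h1.sigma
  refine one_ne_zero ((summable_const_iff (β := ℕ) (1 : ℝ)).1 ?_)
  simpa using h3

theorem exists_not_absolutelySumming (p : ℝ≥0∞) [hp : Fact (1 ≤ p)] {r : ℝ} (hr : 1 ≤ r)
    (hrp : r < 1 / (1 - |(1 / p).toReal - 1 / 2|)) :
    ∃ u : lp (fun _ : ℕ => ℝ) 1 →L[ℝ] lp (fun _ : ℕ => ℝ) p, ¬ AbsolutelySumming r 1 u := by
  obtain ⟨e⟩ : Nonempty (BlockIndex ≃ ℕ) := by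
    obtain ⟨h⟩ := nonempty_denumerable BlockIndex
    exact ⟨Denumerable.eqv BlockIndex⟩
  have hr0 : 0 < r := by linarith
  have hd : 1 - |(1 / p).toReal - 1 / 2| < 1 / r := by
    rcases le_or_gt (1 - |(1 / p).toReal - 1 / 2|) 0 with h | h
    · exact h.trans_lt (by positivity)
    · rwa [lt_one_div h hr0]
  rcases le_total (1 / p).toReal (1 / 2) with h | h
  · rw [abs_of_nonpos (by linarith)] at hd
    obtain ⟨u, hu⟩ := exists_clm_of_bounded (E := lp (fun _ : ℕ => ℝ) p)
      (fun n => ((2 : ℝ) ^ (e.symm n).1) ^ (-(1 / p).toReal) • walshVector e p (e.symm n))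
      (fun n => by
        rw [norm_smul, Real.norm_of_nonneg (by positivity), Real.rpow_neg (by positivity)]
        exact inv_mul_le_one_of_le₀ (norm_walshVector_le e _) (by positivity))
    refine ⟨u, not_absolutelySumming_of_norm_eq e u hr0 hd ?_⟩
    rintro ⟨m, j⟩
    have h1 : u (walshVector e 1 ⟨m, j⟩) =
        (((2 : ℝ) ^ m) ^ (-(1 / p).toReal) * 2 ^ m) • lp.single p (e ⟨m, j⟩) (1 : ℝ) := by
      set c : ℝ := ((2 : ℝ) ^ m) ^ (-(1 / p).toReal) with hc
      have hu' : ∀ k : Fin m → Bool, u (lp.single 1 (e ⟨m, k⟩) (1 : ℝ)) =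
          c • ∑ l, walsh k l • lp.single p (e ⟨m, l⟩) (1 : ℝ) := fun k => by
        rw [hu, Equiv.symm_apply_apply, walshVector]
        simp only [← lp.single_smul, smul_eq_mul, mul_one, hc]
      have hsum : ∀ l : Fin m → Bool, ∑ k, walsh j k * (c * walsh k l) =
          if j = l then c * 2 ^ m else 0 := fun l => by
        have h := sum_walsh_mul_walsh j l
        simp only [mul_left_comm _ c, walsh_comm _ l, ← Finset.mul_sum, h, mul_ite, mul_zero]
      rw [map_walshVector]
      simp only [hu', Finset.smul_sum, smul_smul]
      rw [Finset.sum_comm]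
      simp only [← Finset.sum_smul, hsum, ite_smul, zero_smul, Finset.sum_ite_eq,
        Finset.mem_univ, if_true]
    rw [h1, norm_smul, lp.norm_single (zero_lt_one.trans_le hp.out), norm_one, mul_one,
      Real.norm_of_nonneg (by positivity)]
    nth_rewrite 2 [← Real.rpow_one ((2 : ℝ) ^ m)]
    rw [← Real.rpow_add (by positivity)]
    congr 1
    ring
  · rw [abs_of_nonneg (by linarith)] at hd
    have hp' : p ≠ ⊤ := by
      rintro rfl
      norm_num at h
    obtain ⟨u, hu⟩ := exists_clm_of_bounded (E := lp (fun _ : ℕ => ℝ) p)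
      (fun n => lp.single p n (1 : ℝ))
      (fun n => by rw [lp.norm_single (zero_lt_one.trans_le hp.out), norm_one])
    refine ⟨u, not_absolutelySumming_of_norm_eq e u hr0 hd fun t => ?_⟩
    have h1 : u (walshVector e 1 t) = walshVector e p t := by
      rw [map_walshVector, walshVector]
      refine Finset.sum_congr rfl fun k _ => ?_
      rw [hu, ← lp.single_smul, smul_eq_mul, mul_one]
    rw [h1, norm_walshVector e hp', ENNReal.toReal_div, ENNReal.toReal_one]
    congr 1
    ring

/-- Kwapień: every operator `ℓ₁ → ℓ_p` is absolutely `(r(p),1)`-summing,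
where `1/r(p) = 1 − |1/p − 1/2|`, and for every `1 ≤ r < r(p)` some operator
`ℓ₁ → ℓ_p` is not absolutely `(r,1)`-summing. -/
theorem stmt11 (p : ℝ≥0∞) [Fact (1 ≤ p)] :
    (∀ u : lp (fun _ : ℕ => ℝ) 1 →L[ℝ] lp (fun _ : ℕ => ℝ) p,
      AbsolutelySumming (1 / (1 - |(1 / p).toReal - 1 / 2|)) 1 u) ∧
    (∀ r : ℝ, 1 ≤ r → r < 1 / (1 - |(1 / p).toReal - 1 / 2|) →
      ∃ u : lp (fun _ : ℕ => ℝ) 1 →L[ℝ] lp (fun _ : ℕ => ℝ) p,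
        ¬ AbsolutelySumming r 1 u) := by
  exact ⟨absolutelySumming p, fun _ => exists_not_absolutelySumming p⟩

end
end
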